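/- arXiv:2308.07115 — 6 statements merged into one kernel-verified Lean document; each statement's English description precedes it below -/
import Mathlib

section
/- For every T>0 and μ>0 there exist constants C₁, C₂ > 0 (depending on T and μ) such that for all p, q ∈ ℝ² with |p|² + |q|² ≠ 2μ one has C₁(1 + |p|² + |q|²) ≤ K_T(p,q) ≤ C₂(1 + |p|² + |q|²). -/
open MeasureTheory Real

/-- The kinetic function `K_T(p,q)` on `ℝ² × ℝ²`. -/
noncomputable def KT (T μ : ℝ) (p q : ℝ × ℝ) : ℝ :=
  (p.1 ^ 2 + p.2 ^ 2 + q.1 ^ 2 + q.2 ^ 2 - 2 * μ) /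
    (Real.tanh ((p.1 ^ 2 + p.2 ^ 2 - μ) / (2 * T)) +
      Real.tanh ((q.1 ^ 2 + q.2 ^ 2 - μ) / (2 * T)))

theorem tanh_eq_one_sub_exp_div (x : ℝ) :
    Real.tanh x = (1 - Real.exp (-(2 * x))) / (1 + Real.exp (-(2 * x))) := by
  have h : Real.exp (-(2 * x)) = Real.exp (-x) * Real.exp (-x) := by
    rw [← Real.exp_add]; ring_nf
  have h' : Real.exp x * Real.exp (-x) = 1 := by rw [← Real.exp_add]; simp
  have hx := Real.exp_pos x
  have hx' := Real.exp_pos (-x)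
  rw [Real.tanh_eq, h, div_eq_div_iff (by positivity) (by positivity)]
  linear_combination (2 * Real.exp (-x)) * h'

theorem tanh_pos_of_pos {x : ℝ} (hx : 0 < x) : 0 < Real.tanh x := by
  rw [Real.tanh_eq_sinh_div_cosh]
  exact div_pos (Real.sinh_pos_iff.2 hx) (Real.cosh_pos x)

theorem tanh_ne_zero {x : ℝ} (hx : x ≠ 0) : Real.tanh x ≠ 0 := by
  rw [Real.tanh_eq_sinh_div_cosh]
  exact div_ne_zero (Real.sinh_ne_zero.2 hx) (Real.cosh_pos x).ne'

theorem tanh_mono {x y : ℝ} (h : x ≤ y) : Real.tanh x ≤ Real.tanh y := by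
  have he : Real.exp (-(2 * y)) ≤ Real.exp (-(2 * x)) := Real.exp_le_exp.2 (by linarith)
  have hx := Real.exp_pos (-(2 * x))
  have hy := Real.exp_pos (-(2 * y))
  rw [tanh_eq_one_sub_exp_div, tanh_eq_one_sub_exp_div,
    div_le_div_iff₀ (by positivity) (by positivity)]
  linarith

theorem div_tanh_bounds_of_pos {x : ℝ} (hx : 0 < x) :
    1 / 2 ≤ x / Real.tanh x ∧ x ≤ x / Real.tanh x ∧ x / Real.tanh x ≤ 1 + x := by
  have ht := tanh_pos_of_pos hx
  have he := Real.exp_pos (-(2 * x))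
  refine ⟨?_, ?_, ?_⟩
  · have h := Real.add_one_le_exp (-(2 * x))
    have hle : Real.tanh x ≤ 2 * x := by
      rw [tanh_eq_one_sub_exp_div, div_le_iff₀ (by positivity)]
      nlinarith
    rw [le_div_iff₀ ht]
    linarith
  · rw [le_div_iff₀ ht]
    nlinarith [Real.tanh_lt_one x]
  · have h := Real.add_one_le_exp (2 * x)
    have hm : Real.exp (2 * x) * Real.exp (-(2 * x)) = 1 := by rw [← Real.exp_add]; simp
    rw [div_le_iff₀ ht, tanh_eq_one_sub_exp_div, ← mul_div_assoc, le_div_iff₀ (by positivity)]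
    nlinarith

theorem div_tanh_bounds {x : ℝ} (hx : x ≠ 0) :
    1 / 2 ≤ x / Real.tanh x ∧ |x| ≤ x / Real.tanh x ∧ x / Real.tanh x ≤ 1 + |x| := by
  rcases hx.lt_or_gt with h | h
  · rw [abs_of_neg h]
    simpa [Real.tanh_neg, neg_div_neg_eq] using div_tanh_bounds_of_pos (neg_pos.2 h)
  · rw [abs_of_pos h]
    exact div_tanh_bounds_of_pos h

theorem tanh_add_tanh (a b : ℝ) :
    Real.tanh a + Real.tanh b = Real.tanh (a + b) * (1 + Real.tanh a * Real.tanh b) := by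
  have ha := (Real.cosh_pos a).ne'
  have hb := (Real.cosh_pos b).ne'
  have hab := (Real.cosh_pos (a + b)).ne'
  simp only [Real.tanh_eq_sinh_div_cosh]
  field_simp
  rw [Real.sinh_add, Real.cosh_add]

theorem one_sub_tanh_le_one_add_tanh_mul_tanh {a b m : ℝ} (hm : 0 ≤ m)
    (ha : -m ≤ a) (hb : -m ≤ b) :
    1 - Real.tanh m ≤ 1 + Real.tanh a * Real.tanh b := by
  have ha' := tanh_mono ha
  have hb' := tanh_mono hb
  have hm' := tanh_mono hm
  rw [Real.tanh_neg] at ha' hb'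
  rw [Real.tanh_zero] at hm'
  have := Real.tanh_lt_one a
  have := Real.tanh_lt_one b
  have := Real.neg_one_lt_tanh a
  have := Real.neg_one_lt_tanh b
  rcases le_total 0 (Real.tanh a) with h | h <;> rcases le_total 0 (Real.tanh b) with h' | h' <;>
    nlinarith

theorem one_add_tanh_mul_tanh_le_two (a b : ℝ) : 1 + Real.tanh a * Real.tanh b ≤ 2 := by
  nlinarith [Real.tanh_sq_lt_one a, Real.tanh_sq_lt_one b, sq_nonneg (Real.tanh a - Real.tanh b)]

/-- For every `T > 0` and `μ > 0` there are constants `C₁, C₂ > 0` such that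
`C₁ (1 + |p|² + |q|²) ≤ K_T(p,q) ≤ C₂ (1 + |p|² + |q|²)` whenever `|p|² + |q|² ≠ 2μ`. -/
theorem KT_bounds (T μ : ℝ) (hT : 0 < T) (hμ : 0 < μ) :
    ∃ C₁ > (0 : ℝ), ∃ C₂ > (0 : ℝ), ∀ p q : ℝ × ℝ,
      p.1 ^ 2 + p.2 ^ 2 + q.1 ^ 2 + q.2 ^ 2 ≠ 2 * μ →
      C₁ * (1 + p.1 ^ 2 + p.2 ^ 2 + q.1 ^ 2 + q.2 ^ 2) ≤ KT T μ p q ∧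
        KT T μ p q ≤ C₂ * (1 + p.1 ^ 2 + p.2 ^ 2 + q.1 ^ 2 + q.2 ^ 2) := by
  have hm : 0 < μ / (2 * T) := by positivity
  have hδ : 0 < 1 - Real.tanh (μ / (2 * T)) := by linarith [Real.tanh_lt_one (μ / (2 * T))]
  refine ⟨T / (2 * (1 + 2 * μ) + 2 * T), by positivity,
    (2 * T + 2 * μ + 1) / (1 - Real.tanh (μ / (2 * T))), by positivity, fun p q hpq ↦ ?_⟩
  have hP : 0 ≤ p.1 ^ 2 + p.2 ^ 2 := by positivity
  have hQ : 0 ≤ q.1 ^ 2 + q.2 ^ 2 := by positivity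
  set a := (p.1 ^ 2 + p.2 ^ 2 - μ) / (2 * T) with ha
  set b := (q.1 ^ 2 + q.2 ^ 2 - μ) / (2 * T) with hb
  set m := μ / (2 * T) with hm_def
  have hPa : p.1 ^ 2 + p.2 ^ 2 = 2 * T * a + μ := by rw [ha]; field_simp; ring
  have hQb : q.1 ^ 2 + q.2 ^ 2 = 2 * T * b + μ := by rw [hb]; field_simp; ring
  have hμm : μ = 2 * T * m := by rw [hm_def]; field_simp
  have ham : -m ≤ a := by
    by_contra! h
    nlinarith
  have hbm : -m ≤ b := by
    by_contra! h
    nlinarith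
  have hs : a + b ≠ 0 := fun h ↦ hpq (by linear_combination hPa + hQb + 2 * T * h)
  have hD := one_sub_tanh_le_one_add_tanh_mul_tanh hm.le ham hbm
  have hD2 := one_add_tanh_mul_tanh_le_two a b
  obtain ⟨hR1, hR2, hR3⟩ := div_tanh_bounds hs
  have hK : KT T μ p q =
      2 * T * ((a + b) / Real.tanh (a + b)) / (1 + Real.tanh a * Real.tanh b) := by
    rw [KT, ← ha, ← hb, tanh_add_tanh,
      show p.1 ^ 2 + p.2 ^ 2 + q.1 ^ 2 + q.2 ^ 2 - 2 * μ = 2 * T * (a + b) by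
        linear_combination hPa + hQb]
    have := tanh_ne_zero hs
    have : 1 + Real.tanh a * Real.tanh b ≠ 0 := by linarith
    field_simp
  have hX : 1 + p.1 ^ 2 + p.2 ^ 2 + q.1 ^ 2 + q.2 ^ 2 = 1 + 2 * μ + 2 * T * (a + b) := by
    linear_combination hPa + hQb
  rw [hK, hX]
  generalize (a + b) / Real.tanh (a + b) = R at *
  generalize 1 + Real.tanh a * Real.tanh b = D at *
  have hD0 : 0 < D := by linarith
  constructor
  · calc T / (2 * (1 + 2 * μ) + 2 * T) * (1 + 2 * μ + 2 * T * (a + b))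
        ≤ T * R := by
          rw [div_mul_eq_mul_div, div_le_iff₀ (by positivity), mul_assoc T R]
          have := (le_abs_self (a + b)).trans hR2
          refine mul_le_mul_of_nonneg_left ?_ hT.le
          nlinarith
      _ ≤ 2 * T * R / D := by
          rw [le_div_iff₀ hD0]
          nlinarith [mul_pos hT (show 0 < R by linarith)]
  · rw [div_mul_eq_mul_div]
    have habs : |a + b| ≤ a + b + 4 * m := abs_le.2 ⟨by linarith, by linarith⟩
    have hRT : T * R ≤ T * (1 + (a + b + 4 * m)) := by gcongr; linarith
    refine div_le_div₀ (mul_nonneg (by positivity) (by linarith)) ?_ hδ hD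
    nlinarith
end

section
/- Let T>0, μ>0 and Q₀ < Q₁ be real numbers. Then there exists a constant C > 0 (depending on T, μ, Q₀, Q₁) such that for all p ∈ ℝ², q₁ ∈ ℝ and q₂, q₂' ∈ (Q₀, Q₁) satisfying |p|² + q₁² + q₂² ≠ μ and |p|² + q₁² + q₂'² ≠ μ, one has |B_T(p,(q₁,q₂))⁻¹ − B_T(p,(q₁,q₂'))⁻¹| ≤ C |q₂ − q₂'| (1 + |p|² + q₁²). -/
open MeasureTheory Real

/-- The function `B_T(p,q)` on `ℝ² × ℝ²`, set to `0` on the measure-zero set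
`|p|² + |q|² = μ` where the defining expression is singular. -/
noncomputable def BT (T μ : ℝ) (p q : ℝ × ℝ) : ℝ :=
  if p.1 ^ 2 + p.2 ^ 2 + q.1 ^ 2 + q.2 ^ 2 = μ then 0
  else
    (Real.tanh (((p.1 + q.1) ^ 2 + (p.2 + q.2) ^ 2 - μ) / (2 * T)) +
        Real.tanh (((p.1 - q.1) ^ 2 + (p.2 - q.2) ^ 2 - μ) / (2 * T))) /
      (2 * (p.1 ^ 2 + p.2 ^ 2 + q.1 ^ 2 + q.2 ^ 2 - μ))

/-- The function `s / sinh s` is positive away from the origin. -/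
lemma div_sinh_pos {s : ℝ} (hs : s ≠ 0) : 0 < s / sinh s := by
  rcases lt_or_gt_of_ne hs with h | h
  · exact div_pos_of_neg_of_neg h (sinh_neg_iff.2 h)
  · exact div_pos h (sinh_pos_iff.2 h)

lemma abs_div_sinh_abs (s : ℝ) : |s| / sinh |s| = s / sinh s := by
  rcases abs_cases s with ⟨h, -⟩ | ⟨h, -⟩ <;> rw [h]
  rw [sinh_neg, neg_div_neg_eq]

lemma one_sub_exp_neg_le (x : ℝ) : 1 - exp (-x) ≤ x := by
  linarith [add_one_le_exp (-x)]

lemma hasDerivAt_div_sinh {s : ℝ} (hs : 0 < s) :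
    HasDerivAt (fun x : ℝ => x / sinh x) ((1 * sinh s - s * cosh s) / sinh s ^ 2) s :=
  (hasDerivAt_id s).div (hasDerivAt_sinh s) (sinh_pos_iff.2 hs).ne'

lemma monotoneOn_Ioi_of_hasDerivAt {f f' : ℝ → ℝ} (hf : ∀ x, 0 < x → HasDerivAt f (f' x) x)
    (hf' : ∀ x, 0 < x → 0 ≤ f' x) : MonotoneOn f (Set.Ioi 0) := by
  refine monotoneOn_of_deriv_nonneg (convex_Ioi 0)
    (fun x hx => (hf x hx).continuousAt.continuousWithinAt) ?_ ?_
  · intro x hx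
    rw [interior_Ioi] at hx
    exact (hf x hx).differentiableAt.differentiableWithinAt
  · intro x hx
    rw [interior_Ioi] at hx
    rw [(hf x hx).deriv]
    exact hf' x hx

lemma sinh_mul_exp_neg_le {s : ℝ} : sinh s * exp (-s) ≤ s := by
  have h := one_sub_exp_neg_le (2 * s)
  have h1 : exp (-(2 * s)) = exp (-s) * exp (-s) := by rw [← exp_add]; ring_nf
  have h2 : exp s * exp (-s) = 1 := by rw [← exp_add]; simp
  rw [sinh_eq]
  nlinarith

lemma div_sinh_mul_exp_monotoneOn :
    MonotoneOn (fun x : ℝ => x / sinh x * exp x) (Set.Ioi 0) := by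
  refine monotoneOn_Ioi_of_hasDerivAt
    (fun x hx => (hasDerivAt_div_sinh hx).mul (Real.hasDerivAt_exp x)) fun x hx => ?_
  have hS := sinh_pos_iff.2 hx
  have e : (1 * sinh x - x * cosh x) / sinh x ^ 2 * exp x + x / sinh x * exp x
      = exp x * (sinh x - x * exp (-x)) / sinh x ^ 2 := by
    rw [← cosh_sub_sinh]; field_simp; ring
  rw [e]
  have h1 : exp (-x) ≤ 1 := exp_le_one_iff.2 (by linarith)
  have h2 : x ≤ sinh x := self_le_sinh_iff.2 hx.le
  have : 0 ≤ sinh x - x * exp (-x) := by nlinarith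
  positivity

lemma neg_div_sinh_monotoneOn :
    MonotoneOn (fun x : ℝ => -(x / sinh x)) (Set.Ioi 0) := by
  refine monotoneOn_Ioi_of_hasDerivAt (fun x hx => (hasDerivAt_div_sinh hx).neg) fun x hx => ?_
  have hS := sinh_pos_iff.2 hx
  rw [← neg_div]
  refine div_nonneg ?_ (by positivity)
  obtain ⟨c, ⟨hc0, hcx⟩, hc⟩ := exists_hasDerivAt_eq_slope sinh cosh hx
    continuous_sinh.continuousOn fun y _ => hasDerivAt_sinh y
  have hcc : cosh c ≤ cosh x := by
    rw [cosh_le_cosh, abs_of_pos hc0, abs_of_pos hx]; exact hcx.le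
  rw [sinh_zero, sub_zero, sub_zero] at hc
  rw [hc, div_le_iff₀ hx] at hcc
  linarith

lemma div_sinh_mul_cosh_monotoneOn :
    MonotoneOn (fun x : ℝ => x / sinh x * cosh x) (Set.Ioi 0) := by
  refine monotoneOn_Ioi_of_hasDerivAt
    (fun x hx => (hasDerivAt_div_sinh hx).mul (Real.hasDerivAt_cosh x)) fun x hx => ?_
  have hS := sinh_pos_iff.2 hx
  have e : (1 * sinh x - x * cosh x) / sinh x ^ 2 * cosh x + x / sinh x * sinh x
      = (sinh x * cosh x - x) / sinh x ^ 2 := by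
    field_simp
    linear_combination (-x) * cosh_sq x
  rw [e]
  have h2 : x ≤ sinh x := self_le_sinh_iff.2 hx.le
  have : 0 ≤ sinh x * cosh x - x := by nlinarith [one_le_cosh x]
  positivity

lemma self_sub_div_sinh_mul_cosh_monotoneOn :
    MonotoneOn (fun x : ℝ => x - x / sinh x * cosh x) (Set.Ioi 0) := by
  refine monotoneOn_Ioi_of_hasDerivAt (fun x hx => (hasDerivAt_id x).sub
    ((hasDerivAt_div_sinh hx).mul (Real.hasDerivAt_cosh x))) fun x hx => ?_
  have hS := sinh_pos_iff.2 hx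
  have e : 1 - ((1 * sinh x - x * cosh x) / sinh x ^ 2 * cosh x + x / sinh x * sinh x)
      = (x - sinh x * exp (-x)) / sinh x ^ 2 := by
    rw [← cosh_sub_sinh]
    field_simp
    linear_combination x * cosh_sq x
  rw [e]
  exact div_nonneg (sub_nonneg.2 sinh_mul_exp_neg_le) (by positivity)

/-- The function `s coth s` is Lipschitz with constant `1`. -/
lemma abs_div_sinh_mul_cosh_sub_le {s t : ℝ} (hs : s ≠ 0) (ht : t ≠ 0) :
    |s / sinh s * cosh s - t / sinh t * cosh t| ≤ |s - t| := by
  have key : ∀ a b : ℝ, 0 < a → a ≤ b →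
      |a / sinh a * cosh a - b / sinh b * cosh b| ≤ |a - b| := by
    intro a b ha hab
    have h1 := div_sinh_mul_cosh_monotoneOn ha (ha.trans_le hab) hab
    have h2 := self_sub_div_sinh_mul_cosh_monotoneOn ha (ha.trans_le hab) hab
    simp only at h1 h2
    rw [abs_of_nonpos (by linarith), abs_of_nonpos (by linarith)]
    linarith
  rw [← abs_div_sinh_abs s, ← abs_div_sinh_abs t, ← cosh_abs s, ← cosh_abs t]
  refine le_trans ?_ (abs_abs_sub_abs_le_abs_sub s t)
  rcases le_total |s| |t| with h | h
  · exact key _ _ (abs_pos.2 hs) h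
  · rw [abs_sub_comm, abs_sub_comm |s|]
    exact key _ _ (abs_pos.2 ht) h

lemma div_sinh_le_mul_exp {s t : ℝ} (hs : s ≠ 0) (ht : t ≠ 0) :
    s / sinh s ≤ t / sinh t * exp |s - t| := by
  have h0 := div_sinh_pos (abs_pos.2 ht).ne'
  rw [← abs_div_sinh_abs s, ← abs_div_sinh_abs t]
  rcases le_total |s| |t| with h | h
  · have h1 := div_sinh_mul_exp_monotoneOn (abs_pos.2 hs) (abs_pos.2 ht) h
    simp only at h1
    rw [← le_div_iff₀ (exp_pos _), mul_div_assoc, ← exp_sub] at h1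
    refine h1.trans (mul_le_mul_of_nonneg_left (exp_le_exp.2 ?_) h0.le)
    rw [abs_sub_comm]
    exact abs_sub_abs_le_abs_sub t s
  · have h1 := neg_div_sinh_monotoneOn (abs_pos.2 ht) (abs_pos.2 hs) h
    simp only at h1
    nlinarith [one_le_exp (abs_nonneg (s - t))]

lemma cosh_le_mul_exp (s t : ℝ) : cosh s ≤ cosh t * exp |s - t| := by
  have h1 : exp s ≤ exp t * exp |s - t| := by
    rw [← exp_add]; exact exp_le_exp.2 (by linarith [le_abs_self (s - t)])
  have h2 : exp (-s) ≤ exp (-t) * exp |s - t| := by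
    rw [← exp_add]; exact exp_le_exp.2 (by linarith [neg_abs_le (s - t)])
  rw [cosh_eq, cosh_eq]
  linarith

/-- A logarithmic Lipschitz bound implies a relative Lipschitz bound. -/
lemma abs_sub_le_of_le_mul_exp {u v δ : ℝ} (hu : 0 ≤ u) (hv : 0 ≤ v) (hδ : 0 ≤ δ)
    (huv : u ≤ v * exp δ) (hvu : v ≤ u * exp δ) : |u - v| ≤ δ * (u + v) := by
  have key : ∀ a b : ℝ, 0 ≤ a → a ≤ b * exp δ → a - b ≤ δ * a := by
    intro a b ha h
    have h1 : a * exp (-δ) ≤ b := by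
      rw [exp_neg, ← div_eq_mul_inv]
      exact (div_le_iff₀ (exp_pos _)).2 h
    nlinarith [one_sub_exp_neg_le δ]
  have h1 := key u v hu huv
  have h2 := key v u hv hvu
  rw [abs_le]
  constructor <;> nlinarith

lemma div_sinh_le {s : ℝ} (hs : s ≠ 0) : s / sinh s ≤ (1 + 2 * |s|) * exp (-s) := by
  have h0 : 0 < |s| := abs_pos.2 hs
  have h1 : |s| / sinh |s| ≤ (1 + 2 * |s|) * exp (-|s|) := by
    rw [div_le_iff₀ (sinh_pos_iff.2 h0), sinh_eq]
    have h2 : exp |s| * exp (-|s|) = 1 := by rw [← exp_add]; simp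
    have h3 : exp (-|s|) * exp (-|s|) * (1 + 2 * |s|) ≤ 1 := by
      have h4 : 1 + 2 * |s| ≤ exp |s| * exp |s| := by
        rw [← exp_add]; linarith [add_one_le_exp (|s| + |s|)]
      calc exp (-|s|) * exp (-|s|) * (1 + 2 * |s|)
          ≤ exp (-|s|) * exp (-|s|) * (exp |s| * exp |s|) := by gcongr
        _ = (exp |s| * exp (-|s|)) ^ 2 := by ring
        _ = 1 := by rw [h2]; norm_num
    nlinarith
  rw [← abs_div_sinh_abs s]
  refine h1.trans ?_
  gcongr
  exact le_abs_self s

/-- A Gaussian in the distance to a point at most `Q` away from the origin absorbs a linear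
weight. -/
lemma one_add_abs_mul_exp_le {T Q x y : ℝ} (hT : 0 < T) (hy : |y| ≤ Q) :
    (1 + |x|) * exp (-((x - y) ^ 2 / T)) ≤ 2 + Q + T := by
  have hx : |x| ≤ Q + |x - y| := by
    have := abs_sub_abs_le_abs_sub x y
    linarith
  have hQ : 0 ≤ Q := (abs_nonneg y).trans hy
  have hu : |x - y| ≤ 1 + (x - y) ^ 2 := by
    nlinarith [sq_abs (x - y), sq_nonneg (|x - y| - 1)]
  rw [exp_neg, ← div_eq_mul_inv, div_le_iff₀ (exp_pos _)]
  have he := add_one_le_exp ((x - y) ^ 2 / T)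
  have hd : (x - y) ^ 2 / T * T = (x - y) ^ 2 := div_mul_cancel₀ _ hT.ne'
  have hd0 : 0 ≤ (x - y) ^ 2 / T := by positivity
  calc 1 + |x| ≤ (2 + Q + T) * ((x - y) ^ 2 / T + 1) := by nlinarith
    _ ≤ _ := by gcongr

/-- `B_T(p,q)⁻¹` in terms of `s = (|p|² + |q|² - μ) / T` and `d = 2 p·q / T`. -/
lemma BT_inv_eq {T μ : ℝ} (hT : 0 < T) {p : ℝ × ℝ} {q₁ q₂ s d : ℝ}
    (hne : p.1 ^ 2 + p.2 ^ 2 + q₁ ^ 2 + q₂ ^ 2 ≠ μ)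
    (hs : s = (p.1 ^ 2 + p.2 ^ 2 + q₁ ^ 2 + q₂ ^ 2 - μ) / T)
    (hd : d = 2 * (p.1 * q₁ + p.2 * q₂) / T) :
    (BT T μ p (q₁, q₂))⁻¹ = T * (s / sinh s * cosh s + s / sinh s * cosh d) := by
  have hx : ((p.1 + q₁) ^ 2 + (p.2 + q₂) ^ 2 - μ) / (2 * T) = (s + d) / 2 := by
    rw [hs, hd]; field_simp; ring
  have hy : ((p.1 - q₁) ^ 2 + (p.2 - q₂) ^ 2 - μ) / (2 * T) = (s - d) / 2 := by
    rw [hs, hd]; field_simp; ring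
  have hs' : p.1 ^ 2 + p.2 ^ 2 + q₁ ^ 2 + q₂ ^ 2 - μ = T * s := by
    rw [hs]; field_simp
  have hs0 : s ≠ 0 := by
    rw [hs]; exact div_ne_zero (sub_ne_zero.2 hne) hT.ne'
  simp only [BT, if_neg hne, hx, hy, hs']
  set x := (s + d) / 2 with hxd
  set y := (s - d) / 2 with hyd
  have hsxy : s = x + y := by rw [hxd, hyd]; ring
  have hdxy : d = x - y := by rw [hxd, hyd]; ring
  have hS : sinh s ≠ 0 := fun h => hs0 (sinh_eq_zero.1 h)
  have hcx := (cosh_pos x).ne'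
  have hcy := (cosh_pos y).ne'
  have hsum : tanh x + tanh y = sinh s / (cosh x * cosh y) := by
    rw [hsxy, sinh_add, tanh_eq_sinh_div_cosh, tanh_eq_sinh_div_cosh]; field_simp
  have hprod : cosh s + cosh d = 2 * (cosh x * cosh y) := by
    rw [hsxy, hdxy, cosh_add, cosh_sub]; ring
  rw [hsum, ← mul_add, hprod]
  field_simp

lemma weighted_div_sinh_mul_cosh_le {T μ Q : ℝ} (hT : 0 < T) (hμ : 0 < μ) {p : ℝ × ℝ}
    {q₁ q₂ s d : ℝ} (hq : |q₂| ≤ Q)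
    (hne : p.1 ^ 2 + p.2 ^ 2 + q₁ ^ 2 + q₂ ^ 2 ≠ μ)
    (hs : s = (p.1 ^ 2 + p.2 ^ 2 + q₁ ^ 2 + q₂ ^ 2 - μ) / T)
    (hd : d = 2 * (p.1 * q₁ + p.2 * q₂) / T) :
    (1 + |p.2|) * (s / sinh s * cosh d) ≤
      (1 + 2 * (1 + Q ^ 2 + μ) / T) * (exp (μ / T) * (2 + Q + T)) *
        (1 + p.1 ^ 2 + p.2 ^ 2 + q₁ ^ 2) := by
  have hs0 : s ≠ 0 := by
    rw [hs]; exact div_ne_zero (sub_ne_zero.2 hne) hT.ne'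
  have hQ : 0 ≤ Q := (abs_nonneg q₂).trans hq
  set W := 1 + p.1 ^ 2 + p.2 ^ 2 + q₁ ^ 2 with hW
  have hW1 : 1 ≤ W := by rw [hW]; nlinarith [sq_nonneg p.1, sq_nonneg p.2, sq_nonneg q₁]
  have hq2 : q₂ ^ 2 ≤ Q ^ 2 := sq_le_sq' (by linarith [neg_abs_le q₂]) ((le_abs_self _).trans hq)
  have hsW : 1 + 2 * |s| ≤ (1 + 2 * (1 + Q ^ 2 + μ) / T) * W := by
    have h1 : |s| ≤ (1 + Q ^ 2 + μ) * W / T := by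
      rw [hs, abs_div, abs_of_pos hT]
      gcongr
      rw [abs_le]
      constructor <;> nlinarith [sq_nonneg p.1, sq_nonneg p.2, sq_nonneg q₁, sq_nonneg q₂]
    have h2 : (1 + 2 * (1 + Q ^ 2 + μ) / T) * W = W + 2 * ((1 + Q ^ 2 + μ) * W / T) := by ring
    linarith
  have hexp : ∀ x y : ℝ, |y| ≤ Q → |x| = |p.2| → ∀ e, e ≤ μ / T - (x - y) ^ 2 / T →
      (1 + |p.2|) * exp e ≤ exp (μ / T) * (2 + Q + T) := by
    intro x y hy hx e he
    calc (1 + |p.2|) * exp e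
        ≤ (1 + |p.2|) * exp (μ / T - (x - y) ^ 2 / T) := by gcongr
      _ = exp (μ / T) * ((1 + |x|) * exp (-((x - y) ^ 2 / T))) := by
          rw [sub_eq_add_neg, exp_add, hx]; ring
      _ ≤ _ := by gcongr; exact one_add_abs_mul_exp_le hT hy
  have hplus : (1 + |p.2|) * exp (-s + d) ≤ exp (μ / T) * (2 + Q + T) := by
    refine hexp p.2 q₂ hq rfl _ ?_
    rw [hs, hd, ← sub_nonneg]
    have : μ / T - (p.2 - q₂) ^ 2 / T - (-((p.1 ^ 2 + p.2 ^ 2 + q₁ ^ 2 + q₂ ^ 2 - μ) / T) +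
        2 * (p.1 * q₁ + p.2 * q₂) / T) = (p.1 - q₁) ^ 2 / T := by ring
    rw [this]; positivity
  have hminus : (1 + |p.2|) * exp (-s - d) ≤ exp (μ / T) * (2 + Q + T) := by
    refine hexp p.2 (-q₂) (by rwa [abs_neg]) rfl _ ?_
    rw [hs, hd, ← sub_nonneg]
    have : μ / T - (p.2 - -q₂) ^ 2 / T - (-((p.1 ^ 2 + p.2 ^ 2 + q₁ ^ 2 + q₂ ^ 2 - μ) / T) -
        2 * (p.1 * q₁ + p.2 * q₂) / T) = (p.1 + q₁) ^ 2 / T := by ring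
    rw [this]; positivity
  have hc : (1 + |p.2|) * (exp (-s) * cosh d) ≤ exp (μ / T) * (2 + Q + T) := by
    have : (1 + |p.2|) * (exp (-s) * cosh d)
        = ((1 + |p.2|) * exp (-s + d) + (1 + |p.2|) * exp (-s - d)) / 2 := by
      rw [cosh_eq, sub_eq_add_neg, exp_add, exp_add]; ring
    linarith
  have hcd := cosh_pos d
  calc (1 + |p.2|) * (s / sinh s * cosh d)
      ≤ (1 + |p.2|) * ((1 + 2 * |s|) * exp (-s) * cosh d) := by
        gcongr; exact div_sinh_le hs0
    _ = (1 + 2 * |s|) * ((1 + |p.2|) * (exp (-s) * cosh d)) := by ring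
    _ ≤ ((1 + 2 * (1 + Q ^ 2 + μ) / T) * W) * (exp (μ / T) * (2 + Q + T)) := by gcongr
    _ = _ := by ring

set_option maxHeartbeats 1000000 in
/-- Lipschitz-type estimate for `B_T(p,(q₁,q₂))⁻¹` in the variable `q₂`,
uniformly for `q₂, q₂'` in a bounded interval `(Q₀, Q₁)`. -/
theorem BT_inv_diff_bound (T μ Q₀ Q₁ : ℝ) (hT : 0 < T) (hμ : 0 < μ) (hQ : Q₀ < Q₁) :
    ∃ C > (0 : ℝ), ∀ (p : ℝ × ℝ) (q₁ q₂ q₂' : ℝ),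
      Q₀ < q₂ → q₂ < Q₁ → Q₀ < q₂' → q₂' < Q₁ →
      p.1 ^ 2 + p.2 ^ 2 + q₁ ^ 2 + q₂ ^ 2 ≠ μ →
      p.1 ^ 2 + p.2 ^ 2 + q₁ ^ 2 + q₂' ^ 2 ≠ μ →
      |(BT T μ p (q₁, q₂))⁻¹ - (BT T μ p (q₁, q₂'))⁻¹| ≤
        C * |q₂ - q₂'| * (1 + p.1 ^ 2 + p.2 ^ 2 + q₁ ^ 2) := by
  set Q := |Q₀| + |Q₁| + 1 with hQdef
  have hQ0 : 0 < Q := by positivity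
  set M := (1 + 2 * (1 + Q ^ 2 + μ) / T) * (exp (μ / T) * (2 + Q + T)) with hM
  have hM0 : 0 < M := by positivity
  set E := exp (2 * Q * (2 * Q) / T) with hE
  have hE0 : 0 < E := exp_pos _
  refine ⟨2 * Q + (2 * Q + 2) * ((1 + E) * M), by positivity, ?_⟩
  intro p q₁ q₂ q₂' h1 h2 h3 h4 hne hne'
  have bound : ∀ x, Q₀ < x → x < Q₁ → |x| ≤ Q := by
    intro x hx hx'
    rw [abs_le]
    constructor <;>
      linarith [neg_abs_le Q₀, le_abs_self Q₁, abs_nonneg Q₀, abs_nonneg Q₁]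
  have hq := bound q₂ h1 h2
  have hq' := bound q₂' h3 h4
  obtain ⟨s, hs⟩ : ∃ s, s = (p.1 ^ 2 + p.2 ^ 2 + q₁ ^ 2 + q₂ ^ 2 - μ) / T := ⟨_, rfl⟩
  obtain ⟨d, hd⟩ : ∃ d, d = 2 * (p.1 * q₁ + p.2 * q₂) / T := ⟨_, rfl⟩
  obtain ⟨s', hs'⟩ : ∃ s, s = (p.1 ^ 2 + p.2 ^ 2 + q₁ ^ 2 + q₂' ^ 2 - μ) / T := ⟨_, rfl⟩
  obtain ⟨d', hd'⟩ : ∃ d, d = 2 * (p.1 * q₁ + p.2 * q₂') / T := ⟨_, rfl⟩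
  have hs0 : s ≠ 0 := by
    rw [hs]; exact div_ne_zero (sub_ne_zero.2 hne) hT.ne'
  have hs0' : s' ≠ 0 := by
    rw [hs']; exact div_ne_zero (sub_ne_zero.2 hne') hT.ne'
  have hb := weighted_div_sinh_mul_cosh_le hT hμ hq hne hs hd
  have hb' := weighted_div_sinh_mul_cosh_le hT hμ hq' hne' hs' hd'
  rw [← hM] at hb hb'
  rw [BT_inv_eq hT hne hs hd, BT_inv_eq hT hne' hs' hd']
  have hk := abs_div_sinh_mul_cosh_sub_le hs0 hs0'
  have hle := div_sinh_le_mul_exp hs0 hs0'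
  have hle' := div_sinh_le_mul_exp hs0' hs0
  rw [abs_sub_comm s' s] at hle'
  have hpos := div_sinh_pos hs0
  have hpos' := div_sinh_pos hs0'
  generalize s / sinh s * cosh s = k at *
  generalize s' / sinh s' * cosh s' = k' at *
  generalize s / sinh s = h at *
  generalize s' / sinh s' = h' at *
  have hh := abs_sub_le_of_le_mul_exp hpos.le hpos'.le (abs_nonneg (s - s')) hle hle'
  have hcc := abs_sub_le_of_le_mul_exp (cosh_pos d).le (cosh_pos d').le (abs_nonneg (d - d'))
    (cosh_le_mul_exp d d') (by rw [abs_sub_comm]; exact cosh_le_mul_exp d' d)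
  have hc := cosh_pos d
  have hc' := cosh_pos d'
  generalize cosh d = c at *
  generalize cosh d' = c' at *
  set W := 1 + p.1 ^ 2 + p.2 ^ 2 + q₁ ^ 2 with hW
  have hW1 : 1 ≤ W := by rw [hW]; nlinarith [sq_nonneg p.1, sq_nonneg p.2, sq_nonneg q₁]
  have hdd : |d - d'| = 2 / T * |p.2| * |q₂ - q₂'| := by
    have : d - d' = 2 / T * p.2 * (q₂ - q₂') := by rw [hd, hd']; ring
    rw [this, abs_mul, abs_mul, abs_of_pos (by positivity : 0 < 2 / T)]
  have hss : |s - s'| ≤ 2 * Q / T * |q₂ - q₂'| := by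
    have : s - s' = (q₂ + q₂') / T * (q₂ - q₂') := by rw [hs, hs']; ring
    rw [this, abs_mul, abs_div, abs_of_pos hT]
    gcongr
    linarith [abs_add_le q₂ q₂']
  have hqq : |q₂ - q₂'| ≤ 2 * Q := by linarith [abs_sub q₂ q₂']
  have hEs : exp |s - s'| ≤ E := by
    refine exp_le_exp.2 (hss.trans ?_)
    rw [div_mul_eq_mul_div]
    gcongr
  have hE' : h' ≤ E * h := by
    rw [mul_comm E]
    exact hle'.trans (by gcongr)
  rw [add_mul, one_mul] at hb hb'
  have hA : h * c ≤ M * W := by linarith [mul_nonneg (abs_nonneg p.2) (mul_pos hpos hc).le]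
  have hP : |p.2| * (h * c) ≤ M * W := by linarith [mul_pos hpos hc]
  have hP' : |p.2| * (h' * c') ≤ M * W := by linarith [mul_pos hpos' hc']
  have first : |(h - h') * c| ≤ 2 * Q / T * |q₂ - q₂'| * ((1 + E) * (M * W)) := by
    rw [abs_mul, abs_of_pos hc]
    calc |h - h'| * c ≤ |s - s'| * (h + E * h) * c := by
          gcongr; exact hh.trans (by gcongr)
      _ = |s - s'| * ((1 + E) * (h * c)) := by ring
      _ ≤ _ := by gcongr
  have second : |h' * (c - c')| ≤ 2 / T * |q₂ - q₂'| * ((1 + E) * (M * W)) := by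
    rw [abs_mul, abs_of_pos hpos']
    calc h' * |c - c'| ≤ h' * (|d - d'| * (c + c')) := by gcongr
      _ = 2 / T * |q₂ - q₂'| * (|p.2| * (h' * c) + |p.2| * (h' * c')) := by rw [hdd]; ring
      _ ≤ 2 / T * |q₂ - q₂'| * (|p.2| * (E * h * c) + |p.2| * (h' * c')) := by gcongr
      _ = 2 / T * |q₂ - q₂'| * (E * (|p.2| * (h * c)) + |p.2| * (h' * c')) := by ring
      _ ≤ 2 / T * |q₂ - q₂'| * (E * (M * W) + M * W) := by gcongr
      _ = _ := by ring
  have hk' : |k - k'| ≤ 2 * Q / T * |q₂ - q₂'| * W :=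
    (hk.trans hss).trans (le_mul_of_one_le_right (by positivity) hW1)
  have split : T * (k + h * c) - T * (k' + h' * c')
      = T * ((k - k') + (h - h') * c + h' * (c - c')) := by ring
  rw [split, abs_mul, abs_of_pos hT]
  calc T * |(k - k') + (h - h') * c + h' * (c - c')|
      ≤ T * (2 * Q / T * |q₂ - q₂'| * W + 2 * Q / T * |q₂ - q₂'| * ((1 + E) * (M * W))
          + 2 / T * |q₂ - q₂'| * ((1 + E) * (M * W))) := by
        gcongr
        exact (abs_add_three _ _ _).trans (by gcongr)
    _ = _ := by field_simp; ring
end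

section
/- Let T>0, μ>0 and Q₁>0. Then there is a constant C > 0 (depending only on T, μ and Q₁) such that for all p = (p₁,p₂) ∈ ℝ², q = (q₁,q₂) ∈ ℝ² with |q₂| < Q₁, and all x ∈ ℝ, provided |p|² + q₁² + q₂² ≠ μ and |p|² + q₁² + (q₂+x)² ≠ μ, one has |B_T(p,(q₁,q₂+x)) − B_T(p,(q₁,q₂))| ≤ C |x| / (1 + p₁² + p₂² + q₁²). -/
open MeasureTheory Real

theorem hasDerivAt_tanh_one_sub_sq (u : ℝ) :
    HasDerivAt Real.tanh (1 - Real.tanh u ^ 2) u := by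
  have h : HasDerivAt (fun v => Real.sinh v / Real.cosh v)
      ((Real.cosh u * Real.cosh u - Real.sinh u * Real.sinh u) / Real.cosh u ^ 2) u :=
    (Real.hasDerivAt_sinh u).div (Real.hasDerivAt_cosh u) (Real.cosh_pos u).ne'
  have hfun : Real.tanh = fun v => Real.sinh v / Real.cosh v :=
    funext Real.tanh_eq_sinh_div_cosh
  rw [hfun]
  refine h.congr_deriv ?_
  have := (Real.cosh_pos u).ne'
  field_simp

theorem abs_tanh_le_one (u : ℝ) : |Real.tanh u| ≤ 1 :=
  abs_le.2 ⟨(Real.neg_one_lt_tanh u).le, (Real.tanh_lt_one u).le⟩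

theorem one_sub_tanh_sq_nonneg (u : ℝ) : 0 ≤ 1 - Real.tanh u ^ 2 := by
  nlinarith [Real.neg_one_lt_tanh u, Real.tanh_lt_one u]

theorem one_sub_tanh_sq_mul_abs_le (u : ℝ) : (1 - Real.tanh u ^ 2) * |u| ≤ 1 := by
  have hc := Real.cosh_pos u
  have hs : |u| ≤ Real.sinh |u| := Real.self_le_sinh_iff.2 (abs_nonneg u)
  have hsq : Real.cosh |u| ^ 2 = Real.sinh |u| ^ 2 + 1 := Real.cosh_sq |u|
  rw [Real.cosh_abs] at hsq
  have he : (1 - Real.tanh u ^ 2) = 1 / Real.cosh u ^ 2 := by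
    rw [Real.tanh_eq_sinh_div_cosh]
    field_simp
    linarith [Real.cosh_sq u]
  rw [he, one_div_mul_eq_div, div_le_one (by positivity), hsq]
  nlinarith [abs_nonneg u, sq_nonneg (|u| - 1)]

theorem abs_sub_le_of_hasDerivAt_le {f f' : ℝ → ℝ} {K : ℝ}
    (hf : ∀ y, HasDerivAt f (f' y) y) (hK : ∀ y, |f' y| ≤ K) (x y : ℝ) :
    |f y - f x| ≤ K * |y - x| :=
  convex_univ.norm_image_sub_le_of_norm_hasDerivWithin_le
    (fun z _ => (hf z).hasDerivWithinAt) (fun z _ => hK z) (Set.mem_univ x) (Set.mem_univ y)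

theorem abs_tanh_sub_tanh_le (u v : ℝ) : |Real.tanh u - Real.tanh v| ≤ |u - v| := by
  have h := abs_sub_le_of_hasDerivAt_le (K := 1) hasDerivAt_tanh_one_sub_sq
    (fun y => by
      rw [abs_of_nonneg (one_sub_tanh_sq_nonneg y)]
      nlinarith [sq_nonneg (Real.tanh y)]) v u
  simpa using h

theorem abs_one_sub_tanh_sq_sub_le (u v : ℝ) :
    |(1 - Real.tanh u ^ 2) - (1 - Real.tanh v ^ 2)| ≤ 2 * |u - v| := by
  have h1 := abs_tanh_sub_tanh_le u v
  have h2 : |Real.tanh u + Real.tanh v| ≤ 2 :=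
    (abs_add_le _ _).trans (by linarith [abs_tanh_le_one u, abs_tanh_le_one v])
  calc |(1 - Real.tanh u ^ 2) - (1 - Real.tanh v ^ 2)|
      = |Real.tanh u + Real.tanh v| * |Real.tanh u - Real.tanh v| := by
        rw [← abs_mul, ← abs_neg]; congr 1; ring
    _ ≤ 2 * |u - v| := mul_le_mul h2 h1 (abs_nonneg _) (by norm_num)

/-- The divided difference of `tanh` is Lipschitz off the diagonal. -/
theorem abs_tanh_slope_sub_le {u v u' v' : ℝ} (h : u ≠ v) (h' : u' ≠ v') :
    |(Real.tanh u' - Real.tanh v') / (u' - v') - (Real.tanh u - Real.tanh v) / (u - v)| ≤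
      2 * (|u' - u| + |v' - v|) := by
  have hd : ∀ a b : ℝ, a ≠ b → ∀ t : ℝ,
      HasDerivAt (fun t => Real.tanh (b + t * (a - b)) / (a - b))
        (1 - Real.tanh (b + t * (a - b)) ^ 2) t := by
    intro a b hab t
    have hlin : HasDerivAt (fun t : ℝ => b + t * (a - b)) (a - b) t := by
      simpa using ((hasDerivAt_id t).mul_const (a - b)).const_add b
    refine (((hasDerivAt_tanh_one_sub_sq _).comp t hlin).div_const (a - b)).congr_deriv ?_
    field_simp [sub_ne_zero.2 hab]
  have key := (convex_Icc (0 : ℝ) 1).norm_image_sub_le_of_norm_hasDerivWithin_le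
    (C := 2 * (|u' - u| + |v' - v|))
    (fun t _ => ((hd u' v' h' t).sub (hd u v h t)).hasDerivWithinAt)
    (fun t ht => by
      refine (abs_one_sub_tanh_sq_sub_le _ _).trans ?_
      have e : v' + t * (u' - v') - (v + t * (u - v)) = t * (u' - u) + (1 - t) * (v' - v) := by
        ring
      rw [e]
      have h1 := abs_add_le (t * (u' - u)) ((1 - t) * (v' - v))
      rw [abs_mul, abs_mul, abs_of_nonneg ht.1, abs_of_nonneg (sub_nonneg.2 ht.2)] at h1
      nlinarith [abs_nonneg (u' - u), abs_nonneg (v' - v), ht.1, ht.2])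
    (Set.left_mem_Icc.2 zero_le_one) (Set.right_mem_Icc.2 zero_le_one)
  simp only [Pi.sub_apply, Real.norm_eq_abs, zero_mul, one_mul, add_zero, sub_zero, abs_one,
    mul_one, add_sub_cancel] at key
  refine le_trans (le_of_eq ?_) key
  congr 1
  ring

theorem abs_tanh_add_sq_sub_le {T μ c : ℝ} (hT : 0 < T) (hμ : 0 ≤ μ) (hc : 0 ≤ c) (r s : ℝ) :
    |Real.tanh ((c + s ^ 2 - μ) / (2 * T)) - Real.tanh ((c + r ^ 2 - μ) / (2 * T))| ≤
      (1 + μ + 2 * T) / T * |s - r| := by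
  refine abs_sub_le_of_hasDerivAt_le
    (f := fun y => Real.tanh ((c + y ^ 2 - μ) / (2 * T)))
    (f' := fun y => (1 - Real.tanh ((c + y ^ 2 - μ) / (2 * T)) ^ 2) * (y / T)) ?_ ?_ r s
  · intro y
    have hin : HasDerivAt (fun y : ℝ => (c + y ^ 2 - μ) / (2 * T)) (y / T) y := by
      refine ((((hasDerivAt_pow 2 y).const_add c).sub_const μ).div_const (2 * T)).congr_deriv ?_
      field_simp
      norm_num
    exact (hasDerivAt_tanh_one_sub_sq _).comp y hin
  · intro y
    set w := (c + y ^ 2 - μ) / (2 * T) with hw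
    have h1 := one_sub_tanh_sq_mul_abs_le w
    have h0 := one_sub_tanh_sq_nonneg w
    have hy : |y| ≤ 1 + μ + 2 * T * |w| := by
      have e : 2 * T * w = c + y ^ 2 - μ := by rw [hw]; field_simp
      have : 2 * T * w ≤ 2 * T * |w| := mul_le_mul_of_nonneg_left (le_abs_self w) (by positivity)
      nlinarith [sq_abs y, sq_nonneg (|y| - 1), abs_nonneg y]
    rw [abs_mul, abs_of_nonneg h0, abs_div, abs_of_pos hT, ← mul_div_assoc]
    refine div_le_div_of_nonneg_right ?_ hT.le
    calc (1 - Real.tanh w ^ 2) * |y|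
        ≤ (1 - Real.tanh w ^ 2) * (1 + μ + 2 * T * |w|) := mul_le_mul_of_nonneg_left hy h0
      _ = (1 - Real.tanh w ^ 2) * (1 + μ) + 2 * T * ((1 - Real.tanh w ^ 2) * |w|) := by ring
      _ ≤ 1 + μ + 2 * T := by nlinarith [sq_nonneg (Real.tanh w)]

theorem BT_eq_tanh_slope {T μ : ℝ} (hT : 0 < T) {p q : ℝ × ℝ}
    (h : p.1 ^ 2 + p.2 ^ 2 + q.1 ^ 2 + q.2 ^ 2 ≠ μ) :
    BT T μ p q =
      (Real.tanh (((p.1 + q.1) ^ 2 + (p.2 + q.2) ^ 2 - μ) / (2 * T)) -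
          Real.tanh (-(((p.1 - q.1) ^ 2 + (p.2 - q.2) ^ 2 - μ) / (2 * T)))) /
        (((p.1 + q.1) ^ 2 + (p.2 + q.2) ^ 2 - μ) / (2 * T) -
          -(((p.1 - q.1) ^ 2 + (p.2 - q.2) ^ 2 - μ) / (2 * T))) / (2 * T) := by
  rw [BT, if_neg h, Real.tanh_neg, sub_neg_eq_add, sub_neg_eq_add, div_div]
  congr 1
  field_simp
  ring

theorem tanh_args_ne {T μ : ℝ} (hT : 0 < T) {p q : ℝ × ℝ}
    (h : p.1 ^ 2 + p.2 ^ 2 + q.1 ^ 2 + q.2 ^ 2 ≠ μ) :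
    ((p.1 + q.1) ^ 2 + (p.2 + q.2) ^ 2 - μ) / (2 * T) ≠
      -(((p.1 - q.1) ^ 2 + (p.2 - q.2) ^ 2 - μ) / (2 * T)) := by
  intro e
  apply h
  rw [← neg_div, div_left_inj' (by positivity)] at e
  linarith

theorem abs_BT_le {T μ : ℝ} (hT : 0 < T) (p q : ℝ × ℝ) : |BT T μ p q| ≤ 1 / (2 * T) := by
  by_cases h : p.1 ^ 2 + p.2 ^ 2 + q.1 ^ 2 + q.2 ^ 2 = μ
  · rw [BT, if_pos h, abs_zero]
    positivity
  · rw [BT_eq_tanh_slope hT h, abs_div, abs_of_pos (by positivity : (0 : ℝ) < 2 * T), abs_div]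
    exact div_le_div_of_nonneg_right
      (div_le_one_of_le₀ (abs_tanh_sub_tanh_le _ _) (abs_nonneg _)) (by positivity)

/-- The bound on the bounded region `p₁² + p₂² + q₁² ≤ μ + 1`. -/
theorem abs_BT_sub_le_of_small {T μ Q₁ : ℝ} (hT : 0 < T) (hμ : 0 < μ) (hQ : 0 < Q₁)
    {p q : ℝ × ℝ} {x : ℝ} (hq : |q.2| < Q₁)
    (h : p.1 ^ 2 + p.2 ^ 2 + q.1 ^ 2 + q.2 ^ 2 ≠ μ)
    (h' : p.1 ^ 2 + p.2 ^ 2 + q.1 ^ 2 + (q.2 + x) ^ 2 ≠ μ)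
    (hP : p.1 ^ 2 + p.2 ^ 2 + q.1 ^ 2 ≤ μ + 1) :
    |BT T μ p (q.1, q.2 + x) - BT T μ p q| ≤
      (1 / T + (2 * μ + 2 * Q₁ + 5) / T ^ 2) * |x| := by
  have hx0 := abs_nonneg x
  have hC : 0 ≤ (2 * μ + 2 * Q₁ + 5) / T ^ 2 := by positivity
  have hC' : 0 ≤ 1 / T := by positivity
  rcases le_total 1 |x| with hx | hx
  · calc |BT T μ p (q.1, q.2 + x) - BT T μ p q|
        ≤ |BT T μ p (q.1, q.2 + x)| + |BT T μ p q| := abs_sub _ _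
      _ ≤ 1 / (2 * T) + 1 / (2 * T) := add_le_add (abs_BT_le hT _ _) (abs_BT_le hT _ _)
      _ = 1 / T := by field_simp; norm_num
      _ ≤ _ := by nlinarith
  · have hp : |p.2| ≤ μ + 2 := by
      nlinarith [sq_abs p.2, sq_nonneg (|p.2| - 1), sq_nonneg p.1, sq_nonneg q.1]
    have hs := abs_tanh_slope_sub_le (tanh_args_ne hT h)
      (tanh_args_ne (p := p) (q := (q.1, q.2 + x)) hT h')
    rw [BT_eq_tanh_slope hT h, BT_eq_tanh_slope (p := p) (q := (q.1, q.2 + x)) hT h', ← sub_div,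
      abs_div, abs_of_pos (by positivity : (0 : ℝ) < 2 * T)]
    have hq' := abs_le.1 hq.le
    have hp' := abs_le.1 hp
    have hx' := abs_le.1 hx
    have arg : ∀ d : ℝ, |d| ≤ 2 * μ + 2 * Q₁ + 5 →
        |x * d / (2 * T)| ≤ |x| * (2 * μ + 2 * Q₁ + 5) / (2 * T) := by
      intro d hd
      rw [abs_div, abs_mul, abs_of_pos (by positivity : (0 : ℝ) < 2 * T)]
      gcongr
    have ha := arg (2 * p.2 + 2 * q.2 + x) (abs_le.2 ⟨by linarith, by linarith⟩)
    have hb := arg (2 * p.2 - 2 * q.2 - x) (abs_le.2 ⟨by linarith, by linarith⟩)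
    calc _ ≤ 2 * (|x * (2 * p.2 + 2 * q.2 + x) / (2 * T)| +
          |x * (2 * p.2 - 2 * q.2 - x) / (2 * T)|) / (2 * T) := by
          refine div_le_div_of_nonneg_right (hs.trans (le_of_eq ?_)) (by positivity)
          congr 3 <;> ring
      _ ≤ 2 * (|x| * (2 * μ + 2 * Q₁ + 5) / (2 * T) + |x| * (2 * μ + 2 * Q₁ + 5) / (2 * T)) /
          (2 * T) := by gcongr
      _ = (2 * μ + 2 * Q₁ + 5) / T ^ 2 * |x| := by field_simp; ring
      _ ≤ _ := by nlinarith

/-- The bound on the region `p₁² + p₂² + q₁² ≥ μ + 1`, where the denominator of `BT` is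
bounded below. -/
theorem abs_BT_sub_le_of_large {T μ : ℝ} (hT : 0 < T) (hμ : 0 < μ) {p q : ℝ × ℝ} {x : ℝ}
    (hP : μ + 1 ≤ p.1 ^ 2 + p.2 ^ 2 + q.1 ^ 2) :
    |BT T μ p (q.1, q.2 + x) - BT T μ p q| ≤
      ((1 + μ + 2 * T) / T + 2) * (μ + 2) * |x| / (1 + p.1 ^ 2 + p.2 ^ 2 + q.1 ^ 2) := by
  have h : p.1 ^ 2 + p.2 ^ 2 + q.1 ^ 2 + q.2 ^ 2 ≠ μ := by nlinarith [sq_nonneg q.2]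
  have h' : p.1 ^ 2 + p.2 ^ 2 + q.1 ^ 2 + (q.2 + x) ^ 2 ≠ μ := by nlinarith [sq_nonneg (q.2 + x)]
  have ha := abs_tanh_add_sq_sub_le hT hμ.le (sq_nonneg (p.1 + q.1)) (p.2 + q.2) (p.2 + (q.2 + x))
  have hb := abs_tanh_add_sq_sub_le hT hμ.le (sq_nonneg (p.1 - q.1)) (p.2 - q.2) (p.2 - (q.2 + x))
  rw [show p.2 + (q.2 + x) - (p.2 + q.2) = x by ring] at ha
  rw [show p.2 - (q.2 + x) - (p.2 - q.2) = -x by ring, abs_neg] at hb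
  simp only [BT, if_neg h, if_neg h']
  have ta := abs_tanh_le_one (((p.1 + q.1) ^ 2 + (p.2 + q.2) ^ 2 - μ) / (2 * T))
  have tb := abs_tanh_le_one (((p.1 - q.1) ^ 2 + (p.2 - q.2) ^ 2 - μ) / (2 * T))
  set A := Real.tanh (((p.1 + q.1) ^ 2 + (p.2 + q.2) ^ 2 - μ) / (2 * T))
  set B := Real.tanh (((p.1 - q.1) ^ 2 + (p.2 - q.2) ^ 2 - μ) / (2 * T))
  set A' := Real.tanh (((p.1 + q.1) ^ 2 + (p.2 + (q.2 + x)) ^ 2 - μ) / (2 * T))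
  set B' := Real.tanh (((p.1 - q.1) ^ 2 + (p.2 - (q.2 + x)) ^ 2 - μ) / (2 * T))
  set K := (1 + μ + 2 * T) / T
  set R := 1 + p.1 ^ 2 + p.2 ^ 2 + q.1 ^ 2 with hR
  have hR0 : 0 < R := by positivity
  have hDR : ∀ y : ℝ, R ≤ (μ + 2) * (p.1 ^ 2 + p.2 ^ 2 + q.1 ^ 2 + y ^ 2 - μ) := by
    intro y
    nlinarith [mul_nonneg hμ.le (sq_nonneg y), sq_nonneg y]
  have hDy : ∀ y : ℝ, |y| ≤ p.1 ^ 2 + p.2 ^ 2 + q.1 ^ 2 + y ^ 2 - μ := by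
    intro y
    nlinarith [sq_abs y, sq_nonneg (|y| - 1), abs_nonneg y]
  have hD0 : ∀ y : ℝ, 0 < p.1 ^ 2 + p.2 ^ 2 + q.1 ^ 2 + y ^ 2 - μ := by
    intro y
    nlinarith [sq_nonneg y]
  have hDdiff : p.1 ^ 2 + p.2 ^ 2 + q.1 ^ 2 + q.2 ^ 2 - μ -
      (p.1 ^ 2 + p.2 ^ 2 + q.1 ^ 2 + (q.2 + x) ^ 2 - μ) = -(x * (q.2 + (q.2 + x))) := by ring
  have r := hDR q.2
  have r' := hDR (q.2 + x)
  have y := hDy q.2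
  have y' := hDy (q.2 + x)
  have d := hD0 q.2
  have d' := hD0 (q.2 + x)
  set D := p.1 ^ 2 + p.2 ^ 2 + q.1 ^ 2 + q.2 ^ 2 - μ
  set D' := p.1 ^ 2 + p.2 ^ 2 + q.1 ^ 2 + (q.2 + x) ^ 2 - μ
  have hinv : ∀ E : ℝ, 0 < E → R ≤ (μ + 2) * E → 1 / E ≤ (μ + 2) / R := by
    intro E hE hRE
    rw [div_le_div_iff₀ hE hR0]
    linarith
  have i := hinv D d r
  have i' := hinv D' d' r'
  have hN : |A' + B' - (A + B)| ≤ 2 * K * |x| := by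
    rw [add_sub_add_comm]
    exact (abs_add_le _ _).trans (by linarith)
  have hAB : |A + B| ≤ 2 := (abs_add_le _ _).trans (by linarith)
  have hsplit : (A' + B') / (2 * D') - (A + B) / (2 * D) =
      ((A' + B' - (A + B)) * (1 / D') + (A + B) * (-(x * (q.2 + (q.2 + x))) / (D * D'))) / 2 := by
    rw [← hDdiff]
    field_simp
    ring
  have hquot : |-(x * (q.2 + (q.2 + x))) / (D * D')| ≤ |x| * (2 * ((μ + 2) / R)) := by
    rw [abs_div, abs_neg, abs_mul, abs_of_pos (mul_pos d d'), mul_div_assoc]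
    refine mul_le_mul_of_nonneg_left ?_ (abs_nonneg x)
    calc |q.2 + (q.2 + x)| / (D * D') ≤ (D + D') / (D * D') :=
          div_le_div_of_nonneg_right ((abs_add_le _ _).trans (add_le_add y y')) (by positivity)
      _ = 1 / D' + 1 / D := by field_simp
      _ ≤ 2 * ((μ + 2) / R) := by linarith
  rw [hsplit, abs_div, abs_two]
  calc _ ≤ (2 * K * |x| * ((μ + 2) / R) + 2 * (|x| * (2 * ((μ + 2) / R)))) / 2 := by
        refine div_le_div_of_nonneg_right ((abs_add_le _ _).trans ?_) (by norm_num)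
        rw [abs_mul, abs_mul, abs_of_pos (one_div_pos.2 d')]
        refine add_le_add (mul_le_mul hN i' (by positivity) ((abs_nonneg _).trans hN))
          (mul_le_mul hAB hquot (abs_nonneg _) (by norm_num))
    _ = (K + 2) * (μ + 2) * |x| / R := by ring

/-- The difference quotient bound for `B_T` in the `q₂` variable: for `|q₂| < Q₁`,
`|B_T(p,(q₁,q₂+x)) − B_T(p,(q₁,q₂))| ≤ C |x| / (1 + p₁² + p₂² + q₁²)`. -/
theorem BT_diff_bound (T μ Q₁ : ℝ) (hT : 0 < T) (hμ : 0 < μ) (hQ : 0 < Q₁) :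
    ∃ C > (0 : ℝ), ∀ (p q : ℝ × ℝ) (x : ℝ), |q.2| < Q₁ →
      p.1 ^ 2 + p.2 ^ 2 + q.1 ^ 2 + q.2 ^ 2 ≠ μ →
      p.1 ^ 2 + p.2 ^ 2 + q.1 ^ 2 + (q.2 + x) ^ 2 ≠ μ →
      |BT T μ p (q.1, q.2 + x) - BT T μ p q| ≤
        C * |x| / (1 + p.1 ^ 2 + p.2 ^ 2 + q.1 ^ 2) := by
  set K := (1 + μ + 2 * T) / T with hK
  set L := 1 / T + (2 * μ + 2 * Q₁ + 5) / T ^ 2 with hL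
  have hK0 : 0 < K := by positivity
  have hL0 : 0 < L := by positivity
  refine ⟨(K + 2 + L) * (μ + 2), by positivity, fun p q x hq h h' => ?_⟩
  have hR : 0 < 1 + p.1 ^ 2 + p.2 ^ 2 + q.1 ^ 2 := by positivity
  rcases le_total (p.1 ^ 2 + p.2 ^ 2 + q.1 ^ 2) (μ + 1) with hP | hP
  · refine (abs_BT_sub_le_of_small hT hμ hQ hq h h' hP).trans ?_
    rw [← hL, le_div_iff₀ hR]
    calc L * |x| * (1 + p.1 ^ 2 + p.2 ^ 2 + q.1 ^ 2) ≤ L * |x| * (μ + 2) := by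
          exact mul_le_mul_of_nonneg_left (by linarith) (by positivity)
      _ = L * (μ + 2) * |x| := by ring
      _ ≤ (K + 2 + L) * (μ + 2) * |x| := by gcongr; linarith
  · refine (abs_BT_sub_le_of_large hT hμ hP).trans ?_
    rw [← hK]
    have : K + 2 ≤ K + 2 + L := by linarith
    gcongr
end

section
/- Let μ>0. There exist constants C > 0 and T₀ ∈ (0,μ) such that for all 0 < T < T₀, sup_{q∈ℝ²} ∫_{{p∈ℝ² : |p|²<2μ}} B_T(p,q) dp ≤ C · log(μ/T). -/
open MeasureTheory Real

lemma hasDerivAt_real_tanh (x : ℝ) : HasDerivAt Real.tanh (1 / Real.cosh x ^ 2) x := by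
  have h := (Real.hasDerivAt_sinh x).div (Real.hasDerivAt_cosh x) (Real.cosh_pos x).ne'
  have e : Real.tanh = Real.sinh / Real.cosh := funext Real.tanh_eq_sinh_div_cosh
  rw [e]
  refine h.congr_deriv ?_
  congr 1
  linear_combination Real.cosh_sq x

lemma monotone_real_tanh : Monotone Real.tanh :=
  monotone_of_hasDerivAt_nonneg hasDerivAt_real_tanh fun x => by positivity

lemma monotone_sub_real_tanh : Monotone fun x : ℝ => x - Real.tanh x := by
  refine monotone_of_hasDerivAt_nonneg
    (fun x => (hasDerivAt_id x).sub (hasDerivAt_real_tanh x)) fun x => ?_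
  have h : 1 / Real.cosh x ^ 2 ≤ 1 :=
    (div_le_one (by positivity)).2 (one_le_pow₀ (Real.one_le_cosh x))
  simpa using h

lemma tanh_add_tanh_bounds {x y : ℝ} (h : 0 ≤ x + y) :
    0 ≤ Real.tanh x + Real.tanh y ∧ Real.tanh x + Real.tanh y ≤ x + y := by
  have h₁ : -y ≤ x := by linarith
  have h₂ := monotone_real_tanh h₁
  have h₃ := monotone_sub_real_tanh h₁
  simp only [Real.tanh_neg] at h₂ h₃
  constructor <;> linarith

lemma tanh_add_tanh_div_bounds {T D x y : ℝ} (hT : 0 < T) (hD : D ≠ 0) (hxy : x + y = D / T) :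
    0 ≤ (Real.tanh x + Real.tanh y) / (2 * D) ∧
      (Real.tanh x + Real.tanh y) / (2 * D) ≤ 2 / (2 * T + |D|) := by
  wlog hpos : 0 < D generalizing D x y
  · have hneg : 0 < -D := by
      have := lt_of_le_of_ne (not_lt.1 hpos) hD
      linarith
    have key := this (D := -D) (x := -x) (y := -y) hneg.ne' (by rw [neg_div, ← hxy]; ring) hneg
    have e : (Real.tanh (-x) + Real.tanh (-y)) / (2 * -D) =
        (Real.tanh x + Real.tanh y) / (2 * D) := by
      rw [Real.tanh_neg, Real.tanh_neg, ← neg_add, mul_neg, neg_div_neg_eq]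
    rwa [e, abs_neg] at key
  · obtain ⟨h₀, h₁⟩ := tanh_add_tanh_bounds (x := x) (y := y) (by rw [hxy]; positivity)
    rw [hxy, le_div_iff₀ hT] at h₁
    have h₂ : Real.tanh x + Real.tanh y ≤ 2 := by
      linarith [Real.tanh_lt_one x, Real.tanh_lt_one y]
    refine ⟨by positivity, ?_⟩
    rw [abs_of_pos hpos, div_le_div_iff₀ (by positivity) (by positivity)]
    nlinarith [mul_le_mul_of_nonneg_right h₂ hpos.le]

lemma BT_bounds {T μ : ℝ} (hT : 0 < T) (p q : ℝ × ℝ) :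
    0 ≤ BT T μ p q ∧
      BT T μ p q ≤ 2 / (2 * T + |p.1 ^ 2 + p.2 ^ 2 + q.1 ^ 2 + q.2 ^ 2 - μ|) := by
  unfold BT
  split_ifs with h
  · exact ⟨le_rfl, by positivity⟩
  · exact tanh_add_tanh_div_bounds hT (sub_ne_zero.2 h) (by field_simp; ring)

/-- Replacing a negative center by `0` only brings it closer to nonnegative points. -/
lemma abs_sub_max_zero_le {s : ℝ} (hs : 0 ≤ s) (c : ℝ) : |s - max c 0| ≤ |s - c| := by
  rcases le_total c 0 with h | h
  · rw [max_eq_right h, sub_zero, abs_of_nonneg hs]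
    exact le_trans (by linarith) (le_abs_self _)
  · rw [max_eq_left h]

lemma setIntegral_disc_radial {h : ℝ → ℝ} (hh : Continuous h) {R : ℝ} (hR : 0 ≤ R) :
    ∫ p in {p : ℝ × ℝ | p.1 ^ 2 + p.2 ^ 2 < R}, h (p.1 ^ 2 + p.2 ^ 2) =
      π * ∫ s in (0)..R, h s := by
  have hmeas : MeasurableSet {p : ℝ × ℝ | p.1 ^ 2 + p.2 ^ 2 < R} :=
    (isOpen_lt (by fun_prop) continuous_const).measurableSet
  have hsub : ∫ r in (0)..√R, (h ∘ fun r => r ^ 2) r * (2 * r) = ∫ s in (0)..R, h s := by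
    rw [intervalIntegral.integral_comp_mul_deriv (f := fun r : ℝ => r ^ 2)
      (fun x _ => by simpa using hasDerivAt_pow 2 x) (by fun_prop) hh]
    simp [Real.sq_sqrt hR]
  have hradial : ∫ r in Set.Ioi (0 : ℝ), r * (Set.Iio R).indicator h (r ^ 2) =
      ∫ r in (0)..√R, r * h (r ^ 2) := by
    rw [intervalIntegral.integral_of_le (Real.sqrt_nonneg R), integral_Ioc_eq_integral_Ioo,
      ← Set.Ioi_inter_Iio, ← setIntegral_indicator measurableSet_Iio]
    refine setIntegral_congr_fun measurableSet_Ioi fun r hr => ?_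
    have hiff : r ^ 2 < R ↔ r < √R := (Real.lt_sqrt (le_of_lt hr)).symm
    by_cases hrR : r ^ 2 < R
    · simp [Set.indicator, hrR, hiff.1 hrR]
    · simp [Set.indicator, hrR, mt hiff.2 hrR]
  have hpolar : ∀ p : ℝ × ℝ,
      p.1 • ({p : ℝ × ℝ | p.1 ^ 2 + p.2 ^ 2 < R}.indicator
        (fun p => h (p.1 ^ 2 + p.2 ^ 2)) (polarCoord.symm p)) =
      p.1 * (Set.Iio R).indicator h (p.1 ^ 2) * 1 := by
    intro p
    have e : (p.1 * cos p.2) ^ 2 + (p.1 * sin p.2) ^ 2 = p.1 ^ 2 := by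
      linear_combination p.1 ^ 2 * Real.sin_sq_add_cos_sq p.2
    simp [polarCoord, Set.indicator, e]
  rw [← integral_indicator hmeas, ← integral_comp_polarCoord_symm]
  simp_rw [hpolar]
  rw [show polarCoord.target = Set.Ioi (0 : ℝ) ×ˢ Set.Ioo (-π) π from rfl,
    Measure.volume_eq_prod,
    setIntegral_prod_mul (fun r : ℝ => r * (Set.Iio R).indicator h (r ^ 2)) (fun _ => (1 : ℝ)),
    hradial, ← hsub]
  have e : ∫ r in (0)..√R, (h ∘ fun r => r ^ 2) r * (2 * r) =
      2 * ∫ r in (0)..√R, r * h (r ^ 2) := by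
    rw [← intervalIntegral.integral_const_mul]
    congr 1
    ext r
    simp only [Function.comp]
    ring
  rw [e]
  simp [Real.pi_pos.le]
  ring

lemma intervalIntegral_div_add_abs_sub {a c R : ℝ} (ha : 0 < a) (hc : 0 ≤ c) (hcR : c ≤ R) :
    ∫ s in (0)..R, 2 / (a + |s - c|) =
      2 * (Real.log ((a + c) / a) + Real.log ((a + (R - c)) / a)) := by
  have hcont : Continuous fun s : ℝ => 2 / (a + |s - c|) :=
    continuous_const.div (by fun_prop) fun s => by positivity
  have hbase : ∀ L : ℝ, 0 ≤ L → ∫ t in (0)..L, 2 / (a + t) = 2 * Real.log ((a + L) / a) := by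
    intro L hL
    simp_rw [div_eq_mul_inv (2 : ℝ)]
    rw [intervalIntegral.integral_const_mul,
      intervalIntegral.integral_comp_add_left (fun t : ℝ => t⁻¹),
      integral_inv_of_pos (by linarith) (by linarith), add_zero]
  have hleft : ∫ s in (0)..c, 2 / (a + |s - c|) = 2 * Real.log ((a + c) / a) := by
    rw [← hbase c hc]
    have := intervalIntegral.integral_comp_sub_left (fun t : ℝ => 2 / (a + t)) c (a := 0) (b := c)
    rw [sub_self, sub_zero] at this
    rw [← this]
    refine intervalIntegral.integral_congr fun s hs => ?_
    rw [Set.uIcc_of_le hc] at hs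
    simp only [abs_of_nonpos (sub_nonpos.2 hs.2), neg_sub]
  have hright : ∫ s in c..R, 2 / (a + |s - c|) = 2 * Real.log ((a + (R - c)) / a) := by
    rw [← hbase (R - c) (by linarith)]
    have := intervalIntegral.integral_comp_sub_right (fun t : ℝ => 2 / (a + t)) c
      (a := c) (b := R)
    rw [sub_self] at this
    rw [← this]
    refine intervalIntegral.integral_congr fun s hs => ?_
    rw [Set.uIcc_of_le hcR] at hs
    simp only [abs_of_nonneg (sub_nonneg.2 hs.1)]
  rw [← intervalIntegral.integral_add_adjacent_intervals (hcont.intervalIntegrable 0 c)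
    (hcont.intervalIntegrable c R), hleft, hright]
  ring

lemma integrableOn_disc {f : ℝ × ℝ → ℝ} (hf : Continuous f) (R : ℝ) :
    IntegrableOn f {p : ℝ × ℝ | p.1 ^ 2 + p.2 ^ 2 < R} := by
  refine (hf.continuousOn.integrableOn_compact
    ((isCompact_Icc (a := -√R) (b := √R)).prod
      (isCompact_Icc (a := -√R) (b := √R)))).mono_set fun p hp => ?_
  have hp : p.1 ^ 2 + p.2 ^ 2 < R := hp
  exact ⟨abs_le.1 (Real.abs_le_sqrt (by nlinarith [sq_nonneg p.2])),
    abs_le.1 (Real.abs_le_sqrt (by nlinarith [sq_nonneg p.1]))⟩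

/-- `sup_{q ∈ ℝ²} ∫_{|p|² < 2μ} B_T(p,q) dp = O(log(μ/T))` as `T → 0`. -/
theorem BT_lowmomentum_integral_bound (μ : ℝ) (hμ : 0 < μ) :
    ∃ C > (0 : ℝ), ∃ T₀ : ℝ, 0 < T₀ ∧ T₀ < μ ∧ ∀ T, 0 < T → T < T₀ →
      ∀ q : ℝ × ℝ,
        (∫ p in {p : ℝ × ℝ | p.1 ^ 2 + p.2 ^ 2 < 2 * μ}, BT T μ p q) ≤
          C * Real.log (μ / T) := by
  refine ⟨8 * π, by positivity, μ / 2, by positivity, by linarith, fun T hT hTμ q => ?_⟩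
  set c := max (μ - (q.1 ^ 2 + q.2 ^ 2)) 0 with hc
  have hc₀ : 0 ≤ c := le_max_right _ _
  have hcμ : c ≤ μ := max_le (by nlinarith [sq_nonneg q.1, sq_nonneg q.2]) hμ.le
  have hcont : Continuous fun s : ℝ => 2 / (2 * T + |s - c|) :=
    continuous_const.div (by fun_prop) fun s => by positivity
  have hle : ∀ p : ℝ × ℝ, BT T μ p q ≤ 2 / (2 * T + |p.1 ^ 2 + p.2 ^ 2 - c|) := by
    intro p
    refine (BT_bounds hT p q).2.trans ?_
    have h := abs_sub_max_zero_le (by positivity : 0 ≤ p.1 ^ 2 + p.2 ^ 2)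
      (μ - (q.1 ^ 2 + q.2 ^ 2))
    rw [show p.1 ^ 2 + p.2 ^ 2 - (μ - (q.1 ^ 2 + q.2 ^ 2)) =
      p.1 ^ 2 + p.2 ^ 2 + q.1 ^ 2 + q.2 ^ 2 - μ by ring] at h
    gcongr
  have hlog : ∀ L : ℝ, 0 ≤ L → L ≤ 2 * μ →
      Real.log ((2 * T + L) / (2 * T)) ≤ 2 * Real.log (μ / T) := by
    intro L hL₀ hL
    have hx : 2 < μ / T := (lt_div_iff₀ hT).2 (by linarith)
    have hL' : (2 * T + L) / (2 * T) ≤ 1 + μ / T := by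
      rw [show 1 + μ / T = (2 * T + 2 * μ) / (2 * T) by field_simp]
      gcongr
    rw [show 2 * Real.log (μ / T) = Real.log ((μ / T) ^ 2) by simp]
    exact Real.log_le_log (by positivity) (hL'.trans (by nlinarith))
  calc ∫ p in {p : ℝ × ℝ | p.1 ^ 2 + p.2 ^ 2 < 2 * μ}, BT T μ p q
      ≤ ∫ p in {p : ℝ × ℝ | p.1 ^ 2 + p.2 ^ 2 < 2 * μ},
          2 / (2 * T + |p.1 ^ 2 + p.2 ^ 2 - c|) :=
        integral_mono_of_nonneg (.of_forall fun p => (BT_bounds hT p q).1)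
          (integrableOn_disc (hcont.comp (by fun_prop : Continuous fun p : ℝ × ℝ =>
            p.1 ^ 2 + p.2 ^ 2)) _) (.of_forall hle)
    _ = π * (2 * (Real.log ((2 * T + c) / (2 * T)) +
          Real.log ((2 * T + (2 * μ - c)) / (2 * T)))) := by
        rw [setIntegral_disc_radial hcont (by positivity),
          intervalIntegral_div_add_abs_sub (by positivity) hc₀ (by linarith)]
    _ ≤ π * (2 * (2 * Real.log (μ / T) + 2 * Real.log (μ / T))) := by
        gcongr
        · exact hlog c hc₀ (by linarith)
        · exact hlog _ (by linarith) (by linarith)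
    _ = 8 * π * Real.log (μ / T) := by ring
end

section
/- Let μ>0. There exist constants C > 0 and T₀ ∈ (0,μ) such that for all 0 < T < T₀, sup_{q,q'∈ℝ²} ∫_{ℝ³} B_T((p₁,p₂),q) · B_T((p₁',p₂),q') dp₁ dp₁' dp₂ ≤ C · (log(μ/T))³. -/
open MeasureTheory Real

theorem sinh_le_mul_cosh {s : ℝ} (hs : 0 ≤ s) : sinh s ≤ s * cosh s := by
  have hmono : MonotoneOn (fun x : ℝ => x * cosh x - sinh x) (Set.Ici 0) := by
    refine monotoneOn_of_deriv_nonneg (convex_Ici 0) (by fun_prop) (by fun_prop) fun x hx => ?_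
    have hd : HasDerivAt (fun x : ℝ => x * cosh x - sinh x)
        (1 * cosh x + x * sinh x - cosh x) x :=
      ((hasDerivAt_id x).mul (hasDerivAt_cosh x)).sub (hasDerivAt_sinh x)
    rw [interior_Ici, Set.mem_Ioi] at hx
    rw [hd.deriv]
    nlinarith [mul_nonneg hx.le (sinh_nonneg_iff.2 hx.le)]
  have h := hmono (Set.mem_Ici.2 le_rfl) (Set.mem_Ici.2 hs) hs
  simp only [zero_mul, sinh_zero, sub_zero] at h
  linarith

theorem mul_sinh_le_mul_cosh_add_cosh {s : ℝ} (d : ℝ) (hs : 0 ≤ s) :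
    d * sinh s ≤ s * (cosh s + cosh d) := by
  have h1 := sinh_le_mul_cosh hs
  have hsinh : sinh s ≤ cosh s := (sinh_lt_cosh s).le
  have hs0 : 0 ≤ sinh s := sinh_nonneg_iff.2 hs
  rcases le_total d s with h | h
  · nlinarith [mul_le_mul h hsinh hs0 hs, mul_nonneg hs (cosh_pos d).le]
  · have h2 : d - s ≤ sinh (d - s) := self_le_sinh_iff.2 (by linarith)
    have h3 : (d - s) * cosh s ≤ cosh d := by
      have h4 : sinh d = sinh (d - s) * cosh s + cosh (d - s) * sinh s := by
        rw [← sinh_add]; ring_nf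
      nlinarith [mul_le_mul_of_nonneg_right h2 (cosh_pos s).le, sinh_lt_cosh d,
        mul_nonneg (cosh_pos (d - s)).le hs0]
    nlinarith [mul_le_mul_of_nonneg_left h3 hs, mul_le_mul_of_nonneg_left hsinh hs,
      mul_le_mul_of_nonneg_left h1 (sub_nonneg.2 h)]

theorem abs_tanh_add_tanh_le (x y : ℝ) :
    (1 + |x + y| + |x - y|) * |tanh x + tanh y| ≤ 6 * |x + y| := by
  have key : tanh x + tanh y = 2 * sinh (x + y) / (cosh (x + y) + cosh (x - y)) := by
    have h : cosh (x + y) + cosh (x - y) = 2 * (cosh x * cosh y) := by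
      rw [cosh_add, cosh_sub]; ring
    rw [h, sinh_add, tanh_eq_sinh_div_cosh, tanh_eq_sinh_div_cosh]
    have := (cosh_pos x).ne'
    have := (cosh_pos y).ne'
    field_simp
  have hpos : 0 < cosh (x + y) + cosh (x - y) := add_pos (cosh_pos _) (cosh_pos _)
  rw [key, abs_div, abs_mul, abs_of_pos hpos, abs_two, abs_sinh, ← cosh_abs (x + y),
    ← cosh_abs (x - y)]
  rw [← cosh_abs (x + y), ← cosh_abs (x - y)] at hpos
  set s := |x + y|
  set d := |x - y|
  have hs : 0 ≤ s := abs_nonneg _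
  have hd : 0 ≤ d := abs_nonneg _
  rw [← mul_div_assoc, div_le_iff₀ hpos]
  have h1 := sinh_le_mul_cosh hs
  have h2 := mul_sinh_le_mul_cosh_add_cosh d hs
  have h3 := mul_le_mul_of_nonneg_left (sinh_lt_cosh s).le hs
  have h4 := mul_nonneg hs (cosh_pos d).le
  nlinarith

/-- For `a = μ - |q|²` and `p = (x, y)` this is `1 / (T + ||p|² + |q|² - μ| + |p ⬝ q|)`, which
controls `BT T μ p q`. -/
noncomputable def majorant (T a : ℝ) (q : ℝ × ℝ) (x y : ℝ) : ℝ :=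
  1 / (T + |x ^ 2 - (a - y ^ 2)| + |x * q.1 + y * q.2|)

theorem abs_BT_le_s5 {T : ℝ} (hT : 0 < T) (μ : ℝ) (q : ℝ × ℝ) (x y : ℝ) :
    |BT T μ (x, y) q| ≤ 3 * majorant T (μ - q.1 ^ 2 - q.2 ^ 2) q x y := by
  unfold BT majorant
  dsimp only
  have hD : 0 < T + |x ^ 2 - (μ - q.1 ^ 2 - q.2 ^ 2 - y ^ 2)| + |x * q.1 + y * q.2| := by
    positivity
  split_ifs with h
  · rw [abs_zero]; positivity
  · have hs : x ^ 2 + y ^ 2 + q.1 ^ 2 + q.2 ^ 2 - μ ≠ 0 := sub_ne_zero.2 h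
    have key := abs_tanh_add_tanh_le (((x + q.1) ^ 2 + (y + q.2) ^ 2 - μ) / (2 * T))
      (((x - q.1) ^ 2 + (y - q.2) ^ 2 - μ) / (2 * T))
    have e1 : ((x + q.1) ^ 2 + (y + q.2) ^ 2 - μ) / (2 * T) +
        ((x - q.1) ^ 2 + (y - q.2) ^ 2 - μ) / (2 * T) =
        (x ^ 2 + y ^ 2 + q.1 ^ 2 + q.2 ^ 2 - μ) / T := by
      field_simp; ring
    have e2 : ((x + q.1) ^ 2 + (y + q.2) ^ 2 - μ) / (2 * T) -
        ((x - q.1) ^ 2 + (y - q.2) ^ 2 - μ) / (2 * T) = 2 * (x * q.1 + y * q.2) / T := by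
      field_simp; ring
    have e3 : x ^ 2 - (μ - q.1 ^ 2 - q.2 ^ 2 - y ^ 2) =
      x ^ 2 + y ^ 2 + q.1 ^ 2 + q.2 ^ 2 - μ := by ring
    rw [e1, e2, abs_div, abs_div, abs_of_pos hT, abs_mul, abs_two] at key
    rw [e3] at hD ⊢
    rw [abs_div, abs_mul, abs_two, mul_one_div, div_le_div_iff₀ (by positivity) hD]
    set s := |x ^ 2 + y ^ 2 + q.1 ^ 2 + q.2 ^ 2 - μ|
    set k := |x * q.1 + y * q.2|
    set t := |tanh (((x + q.1) ^ 2 + (y + q.2) ^ 2 - μ) / (2 * T)) +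
      tanh (((x - q.1) ^ 2 + (y - q.2) ^ 2 - μ) / (2 * T))|
    have hk : 0 ≤ k * t := by positivity
    have e4 : 1 + s / T + 2 * k / T = (T + s + 2 * k) / T := by field_simp
    rw [e4, div_mul_eq_mul_div, ← mul_div_assoc, div_le_div_iff_of_pos_right hT] at key
    nlinarith

/-- The one-dimensional profile dominating all slices of the kernel. -/
noncomputable def profile (T h u : ℝ) : ℝ := 1 / (T + h * |u| + u ^ 2)

theorem profile_nonneg {T h : ℝ} (hT : 0 < T) (hh : 0 < h) (u : ℝ) : 0 ≤ profile T h u := by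
  unfold profile; positivity

theorem measurable_profile (T h : ℝ) : Measurable (profile T h) := by
  unfold profile; fun_prop

theorem integral_Ioi_one_div_mul {a b : ℝ} (ha : 0 < a) (hab : a < b) :
    ∫ u in Set.Ioi (0 : ℝ), 1 / ((u + a) * (u + b)) = log (b / a) / (b - a) := by
  have hb : 0 < b := ha.trans hab
  have hba : b - a ≠ 0 := (sub_pos.2 hab).ne'
  have hderiv : ∀ x ∈ Set.Ici (0 : ℝ), HasDerivAt
      (fun u : ℝ => log ((u + a) / (u + b)) / (b - a)) (1 / ((x + a) * (x + b))) x := by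
    intro x hx
    have hx : 0 ≤ x := hx
    have hxa : x + a ≠ 0 := by positivity
    have hxb : x + b ≠ 0 := by positivity
    have h : HasDerivAt (fun u : ℝ => log ((u + a) / (u + b)) / (b - a))
        ((1 * (x + b) - (x + a) * 1) / (x + b) ^ 2 / ((x + a) / (x + b)) / (b - a)) x :=
      ((((hasDerivAt_id x).add_const a).div ((hasDerivAt_id x).add_const b)
        hxb).log (div_ne_zero hxa hxb)).div_const (b - a)
    convert h using 1
    field_simp
    ring
  have hlim : Filter.Tendsto (fun u : ℝ => log ((u + a) / (u + b)) / (b - a))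
      Filter.atTop (nhds 0) := by
    have h1 : Filter.Tendsto (fun u : ℝ => 1 - (b - a) / (u + b)) Filter.atTop (nhds 1) := by
      have := (Filter.tendsto_atTop_add_const_right Filter.atTop b
        Filter.tendsto_id).const_div_atTop (b - a)
      simpa using this.const_sub 1
    have h2 : Filter.Tendsto (fun u : ℝ => (u + a) / (u + b)) Filter.atTop (nhds 1) := by
      refine h1.congr' ?_
      filter_upwards [Filter.eventually_gt_atTop 0] with u hu
      have : u + b ≠ 0 := by positivity
      field_simp
      ring
    have h3 := (h2.log one_ne_zero).div_const (b - a)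
    simpa using h3
  rw [integral_Ioi_of_hasDerivAt_of_nonneg' hderiv (fun x hx => ?_) hlim]
  · rw [zero_add, zero_add, ← inv_div b a, log_inv]; ring
  · have hx : 0 < x := hx
    positivity

theorem lintegral_profile_le {T h : ℝ} (hT : 0 < T) (hh : 0 < h) (hTh : T ≤ h ^ 2) :
    ∫⁻ u, ENNReal.ofReal (profile T h u) ≤ ENNReal.ofReal (6 * log (2 * h ^ 2 / T) / h) := by
  have ha : 0 < T / h := by positivity
  have hah : T / h ≤ h := by rw [div_le_iff₀ hh]; nlinarith
  have hab : T / h < 2 * h := by linarith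
  have hint := integral_comp_abs (f := fun u : ℝ => 1 / ((u + T / h) * (u + 2 * h)))
  rw [integral_Ioi_one_div_mul ha hab] at hint
  have hdiv : 2 * h / (T / h) = 2 * h ^ 2 / T := by field_simp
  have hlog : 0 < log (2 * h / (T / h)) := log_pos (by rw [one_lt_div ha]; exact hab)
  have hba : 0 < 2 * h - T / h := sub_pos.2 hab
  have hi : Integrable (fun u : ℝ => 1 / ((|u| + T / h) * (|u| + 2 * h))) := by
    refine Integrable.of_integral_ne_zero ?_
    rw [hint]
    positivity
  have hle : ∀ u : ℝ, profile T h u ≤ 3 * (1 / ((|u| + T / h) * (|u| + 2 * h))) := by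
    intro u
    have hu : 0 ≤ |u| := abs_nonneg u
    have e : T / h * h = T := by field_simp
    unfold profile
    rw [mul_one_div, div_le_div_iff₀ (by positivity) (by positivity), ← sq_abs u]
    nlinarith [mul_le_mul_of_nonneg_right hah hu, mul_nonneg hh.le hu, sq_nonneg |u|]
  calc ∫⁻ u, ENNReal.ofReal (profile T h u)
      ≤ ∫⁻ u, ENNReal.ofReal (3 * (1 / ((|u| + T / h) * (|u| + 2 * h)))) :=
        lintegral_mono fun u => ENNReal.ofReal_le_ofReal (hle u)
    _ = ENNReal.ofReal (∫ u, 3 * (1 / ((|u| + T / h) * (|u| + 2 * h)))) :=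
        (ofReal_integral_eq_lintegral_ofReal (hi.const_mul 3)
          (Filter.Eventually.of_forall fun u => by
            have := abs_nonneg u
            simp only [Pi.zero_apply]
            positivity)).symm
    _ ≤ _ := by
        refine ENNReal.ofReal_le_ofReal ?_
        rw [integral_const_mul, hint, hdiv]
        rw [hdiv] at hlog
        have : log (2 * h ^ 2 / T) / (2 * h - T / h) ≤ log (2 * h ^ 2 / T) / h :=
          div_le_div_of_nonneg_left hlog.le hh (by linarith)
        rw [mul_div_assoc 6]
        linarith

theorem majorant_nonneg {T : ℝ} (hT : 0 < T) (a : ℝ) (q : ℝ × ℝ) (x y : ℝ) :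
    0 ≤ majorant T a q x y := by
  unfold majorant; positivity

theorem measurable_uncurry_majorant (T a : ℝ) (q : ℝ × ℝ) :
    Measurable (Function.uncurry (majorant T a q)) := by
  unfold majorant Function.uncurry; fun_prop

theorem one_div_le_four_mul_profile {T h D u : ℝ} (hT : 0 < T) (hh : 0 < h) (hD : 0 < D)
    (hle : T + h * |u| + u ^ 2 ≤ 4 * D) : 1 / D ≤ 4 * profile T h u := by
  unfold profile
  rw [mul_one_div, div_le_div_iff₀ hD (by positivity)]
  linarith

/-- Each slice of the kernel is dominated by four translates of the profile. -/
theorem exists_slice_le {T h m r k : ℝ} (hT : 0 < T) (hh : 0 < h) (hTh : T ≤ h ^ 2)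
    (H : h ≤ |r| ∨ h ^ 2 ≤ T + |k| ∨ h ^ 2 ≤ T + |m|) :
    ∃ M c : ℝ, ∀ x : ℝ, 1 / (T + |x ^ 2 - m| + |x * r + k|) ≤
      4 * (profile T h x + profile T h (x - M) + profile T h (x + M) + profile T h (x - c)) := by
  set c := max (-(h / 2)) (min (h / 2) (-k / r)) with hc
  refine ⟨√m, c, fun x => ?_⟩
  have hD : 0 < T + |x ^ 2 - m| + |x * r + k| := by positivity
  have p1 := profile_nonneg hT hh x
  have p2 := profile_nonneg hT hh (x - √m)
  have p3 := profile_nonneg hT hh (x + √m)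
  have p4 := profile_nonneg hT hh (x - c)
  rcases le_or_gt |x| (h / 2) with hx | hx
  · have hx2 : x ^ 2 ≤ h ^ 2 / 4 := by
      rw [← sq_abs]; nlinarith [abs_nonneg x]
    have hfar : h ^ 2 / 2 ≤ T + |x ^ 2 - m| + |x * r + k| →
        1 / (T + |x ^ 2 - m| + |x * r + k|) ≤ 4 * profile T h x := fun hle =>
      one_div_le_four_mul_profile hT hh hD (by nlinarith)
    rcases le_or_gt h |r| with hr | hr
    · have hcl : -(h / 2) ≤ c := le_max_left _ _
      have hcu : c ≤ h / 2 := max_le (by linarith) (min_le_left _ _)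
      have hr0 : r ≠ 0 := by
        rintro rfl
        rw [abs_zero] at hr; linarith
      obtain ⟨hxl, hxu⟩ := abs_le.1 hx
      have hclamp : |x - c| ≤ |x - -k / r| := by
        rcases le_total (-k / r) (h / 2) with h1 | h1
        · rcases le_total (-(h / 2)) (-k / r) with h2 | h2
          · rw [hc, min_eq_right h1, max_eq_right h2]
          · rw [hc, min_eq_right h1, max_eq_left h2, abs_of_nonneg (by linarith),
              abs_of_nonneg (by linarith)]
            linarith
        · rw [hc, min_eq_left h1, max_eq_right (by linarith), abs_sub_comm x,
            abs_sub_comm x, abs_of_nonneg (by linarith), abs_of_nonneg (by linarith)]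
          linarith
      have hlin : |x * r + k| = |r| * |x - -k / r| := by
        rw [← abs_mul]; congr 1; field_simp; ring
      have hu : |x - c| ≤ h := abs_le.2 ⟨by linarith, by linarith⟩
      have hge : h * |x - c| ≤ |x * r + k| := by
        rw [hlin]; exact mul_le_mul hr hclamp (abs_nonneg _) (abs_nonneg _)
      have := one_div_le_four_mul_profile (u := x - c) hT hh hD (by
        rw [← sq_abs (x - c)]
        nlinarith [abs_nonneg (x ^ 2 - m), abs_nonneg (x - c)])
      linarith
    · have : h ^ 2 / 2 ≤ T + |x ^ 2 - m| + |x * r + k| := by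
        rcases H with H | H | H
        · linarith
        · have h1 : |x * r| ≤ h ^ 2 / 2 := by
            rw [abs_mul]
            nlinarith [mul_le_mul hx hr.le (abs_nonneg r) (by positivity)]
          have h2 : |k| ≤ |x * r + k| + |x * r| := by
            have := abs_sub (x * r + k) (x * r)
            rwa [add_sub_cancel_left] at this
          linarith [abs_nonneg (x ^ 2 - m)]
        · have h2 : |m| ≤ |x ^ 2| + |x ^ 2 - m| := by
            have := abs_sub (x ^ 2) (x ^ 2 - m)
            rwa [sub_sub_cancel] at this
          rw [abs_of_nonneg (sq_nonneg x)] at h2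
          nlinarith [abs_nonneg (x * r + k)]
      linarith [hfar this]
  · have hM : 0 ≤ √m := sqrt_nonneg m
    have hprod : |(|x| - √m)| * (|x| + √m) ≤ |x ^ 2 - m| := by
      rcases le_total 0 m with hm | hm
      · rw [← abs_of_nonneg (add_nonneg (abs_nonneg x) hM), ← abs_mul]
        refine le_of_eq ?_
        congr 1
        nlinarith [sq_abs x, sq_sqrt hm]
      · rw [sqrt_eq_zero_of_nonpos hm, abs_of_nonneg (by linarith [sq_nonneg x] : 0 ≤ x ^ 2 - m)]
        rw [sub_zero, add_zero, abs_abs]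
        nlinarith [sq_abs x]
    have hux : |(|x| - √m)| ≤ |x| + √m := by
      rw [abs_le]; constructor <;> linarith [abs_nonneg x]
    have hmain : T + h * |(|x| - √m)| + (|x| - √m) ^ 2 ≤
        4 * (T + |x ^ 2 - m| + |x * r + k|) := by
      rw [← sq_abs (|x| - √m)]
      have h1 := mul_le_mul_of_nonneg_left hux (abs_nonneg (|x| - √m))
      have h2 := mul_le_mul_of_nonneg_left (by linarith : h / 2 ≤ |x| + √m)
        (abs_nonneg (|x| - √m))
      nlinarith [abs_nonneg (x * r + k)]
    have := one_div_le_four_mul_profile hT hh hD hmain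
    rcases le_total 0 x with h0 | h0
    · rw [abs_of_nonneg h0] at this
      linarith
    · have e : profile T h (|x| - √m) = profile T h (x + √m) := by
        rw [abs_of_nonpos h0]
        unfold profile
        rw [show -x - √m = -(x + √m) by ring, abs_neg, neg_sq]
      rw [e] at this
      linarith

theorem lintegral_slice_le {T h m r k : ℝ} (hT : 0 < T) (hh : 0 < h) (hTh : T ≤ h ^ 2)
    (H : h ≤ |r| ∨ h ^ 2 ≤ T + |k| ∨ h ^ 2 ≤ T + |m|) :
    ∫⁻ x : ℝ, ENNReal.ofReal (1 / (T + |x ^ 2 - m| + |x * r + k|)) ≤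
      ENNReal.ofReal (96 * log (2 * h ^ 2 / T) / h) := by
  obtain ⟨M, c, hMc⟩ := exists_slice_le hT hh hTh H
  have hmeas := (measurable_profile T h).ennreal_ofReal
  have hprof := lintegral_profile_le hT hh hTh
  have hlog : 0 ≤ log (2 * h ^ 2 / T) := log_nonneg (by rw [one_le_div hT]; linarith)
  set G : ℝ → ENNReal := fun u => ENNReal.ofReal (profile T h u) with hG
  calc ∫⁻ x : ℝ, ENNReal.ofReal (1 / (T + |x ^ 2 - m| + |x * r + k|))
      ≤ ∫⁻ x, ENNReal.ofReal 4 * (G x + G (x - M) + G (x + M) + G (x - c)) := by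
        refine lintegral_mono fun x => ?_
        have p := profile_nonneg hT hh
        simp only [hG]
        rw [← ENNReal.ofReal_add (p _) (p _), ← ENNReal.ofReal_add (add_nonneg (p _) (p _)) (p _),
          ← ENNReal.ofReal_add (add_nonneg (add_nonneg (p _) (p _)) (p _)) (p _),
          ← ENNReal.ofReal_mul (by norm_num)]
        exact ENNReal.ofReal_le_ofReal (hMc x)
    _ = ENNReal.ofReal 4 * ((∫⁻ x, G x) + (∫⁻ x, G x) + (∫⁻ x, G x) + (∫⁻ x, G x)) := by
        have m1 : Measurable fun x => G (x - M) := hmeas.comp (measurable_sub_const M)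
        have m2 : Measurable fun x => G (x + M) := hmeas.comp (measurable_add_const M)
        have m3 : Measurable fun x => G x + G (x - M) := hmeas.add m1
        have m4 : Measurable fun x => G x + G (x - M) + G (x + M) := m3.add m2
        rw [lintegral_const_mul' _ _ ENNReal.ofReal_ne_top,
          lintegral_add_left m4, lintegral_add_left m3,
          lintegral_add_left hmeas, lintegral_sub_right_eq_self, lintegral_sub_right_eq_self,
          lintegral_add_right_eq_self]
    _ ≤ ENNReal.ofReal 4 * (ENNReal.ofReal (6 * log (2 * h ^ 2 / T) / h) +
          ENNReal.ofReal (6 * log (2 * h ^ 2 / T) / h) +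
          ENNReal.ofReal (6 * log (2 * h ^ 2 / T) / h) +
          ENNReal.ofReal (6 * log (2 * h ^ 2 / T) / h)) := by gcongr
    _ = _ := by
        have : 0 ≤ 6 * log (2 * h ^ 2 / T) / h := by positivity
        rw [← ENNReal.ofReal_add this this, ← ENNReal.ofReal_add (by positivity) this,
          ← ENNReal.ofReal_add (by positivity) this, ← ENNReal.ofReal_mul (by norm_num)]
        congr 1
        ring

theorem log_le_add_log {μ T A c : ℝ} (hT : 0 < T) (hTμ : T < μ / 4) (hA : 0 < A)
    (hAc : A ≤ c * μ) {n : ℝ} (hcn : c ≤ exp n) :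
    log (A / T) ≤ n + log (μ / T) := by
  have hμ : 0 < μ := by linarith
  calc log (A / T) ≤ log (exp n * (μ / T)) := by
        refine log_le_log (by positivity) ?_
        rw [← mul_div_assoc]
        gcongr
        exact hAc.trans (by gcongr)
    _ = n + log (μ / T) := by rw [log_mul (exp_pos n).ne' (by positivity), log_exp]

theorem one_le_log_div {μ T : ℝ} (hT : 0 < T) (hTμ : T < μ / 4) : 1 ≤ log (μ / T) := by
  rw [le_log_iff_exp_le (div_pos (by linarith) hT), le_div_iff₀ hT]
  nlinarith [exp_one_lt_three]

theorem log_le_three_mul_log {μ T A : ℝ} (hT : 0 < T) (hTμ : T < μ / 4) (hA : 0 < A)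
    (hAμ : A ≤ 6 * μ) : log (A / T) ≤ 3 * log (μ / T) := by
  have h6 : (6 : ℝ) ≤ exp 2 := by
    rw [show (2 : ℝ) = 1 + 1 by norm_num, exp_add]
    nlinarith [exp_one_gt_d9]
  linarith [log_le_add_log hT hTμ hA hAμ h6, one_le_log_div hT hTμ]

theorem lintegral_slice_le_log {μ T h m r k : ℝ} (hT : 0 < T) (hTμ : T < μ / 4) (hh : 0 < h)
    (hTh : T ≤ h ^ 2) (hhμ : h ^ 2 ≤ 3 * μ)
    (H : h ≤ |r| ∨ h ^ 2 ≤ T + |k| ∨ h ^ 2 ≤ T + |m|) :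
    ∫⁻ x : ℝ, ENNReal.ofReal (1 / (T + |x ^ 2 - m| + |x * r + k|)) ≤
      ENNReal.ofReal (288 * log (μ / T) / h) := by
  refine (lintegral_slice_le hT hh hTh H).trans (ENNReal.ofReal_le_ofReal ?_)
  have := log_le_three_mul_log hT hTμ (by positivity : 0 < 2 * h ^ 2) (by linarith)
  gcongr ?_ / h
  linarith

theorem lintegral_slice_le_of_le {μ T m : ℝ} (r k : ℝ) (hT : 0 < T) (hTμ : T < μ / 4)
    (hm : m ≤ μ) :
    ∫⁻ x : ℝ, ENNReal.ofReal (1 / (T + |x ^ 2 - m| + |x * r + k|)) ≤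
      ENNReal.ofReal (288 * log (μ / T) / √(T + |m|)) := by
  have hpos : 0 < T + |m| := by positivity
  have hsq : √(T + |m|) ^ 2 = T + |m| := sq_sqrt hpos.le
  have hs : 0 < √(T + |m|) := sqrt_pos.2 hpos
  rcases le_total 0 m with h0 | h0
  · refine lintegral_slice_le_log hT hTμ hs ?_ ?_ (Or.inr (Or.inr hsq.le))
    · rw [hsq]; linarith [abs_nonneg m]
    · rw [hsq, abs_of_nonneg h0]; linarith
  · calc ∫⁻ x : ℝ, ENNReal.ofReal (1 / (T + |x ^ 2 - m| + |x * r + k|))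
        ≤ ∫⁻ x : ℝ, ENNReal.ofReal (1 / (T + |m| + |x ^ 2 - 0| + |x * 0 + 0|)) := by
          refine lintegral_mono fun x => ENNReal.ofReal_le_ofReal ?_
          refine one_div_le_one_div_of_le (by positivity) ?_
          rw [abs_of_nonneg (by linarith [sq_nonneg x] : 0 ≤ x ^ 2 - m), abs_of_nonpos h0,
            mul_zero, add_zero, abs_zero, sub_zero, abs_of_nonneg (sq_nonneg x)]
          linarith [abs_nonneg (x * r + k)]
      _ ≤ ENNReal.ofReal (96 * log (2 * √(T + |m|) ^ 2 / (T + |m|)) / √(T + |m|)) :=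
          lintegral_slice_le hpos hs hsq.ge (Or.inr (Or.inr (by rw [hsq]; simp)))
      _ ≤ _ := by
          refine ENNReal.ofReal_le_ofReal ?_
          rw [hsq, mul_div_assoc 2, div_self hpos.ne', mul_one]
          gcongr ?_ / _
          linarith [one_le_log_div hT hTμ, log_two_lt_d9]

theorem ofReal_div_sq_le {A h B : ℝ} (hh : 0 < h) (hB : 0 < B) {c : ℝ}
    (hBh : B ≤ c * h ^ 2) {I : ENNReal} (hI : I ≤ ENNReal.ofReal (A / h)) :
    I ^ 2 ≤ ENNReal.ofReal (c * A ^ 2) * ENNReal.ofReal (1 / B) := by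
  have hc : 0 < c := pos_of_mul_pos_left (hB.trans_le hBh) (sq_nonneg h)
  refine (pow_le_pow_left' hI 2).trans ?_
  rw [← ENNReal.ofReal_mul (by positivity)]
  rcases le_total 0 (A / h) with h0 | h0
  · rw [← ENNReal.ofReal_pow h0]
    refine ENNReal.ofReal_le_ofReal ?_
    rw [div_pow, mul_one_div, div_le_div_iff₀ (by positivity) hB]
    nlinarith [mul_le_mul_of_nonneg_left hBh (sq_nonneg A)]
  · simp [ENNReal.ofReal_of_nonpos h0]

theorem sq_slice_le_profile {μ T : ℝ} (hT : 0 < T) (hTμ : T < μ / 4) (q : ℝ × ℝ)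
    (ha : |μ - q.1 ^ 2 - q.2 ^ 2| < μ / 2) (y : ℝ) :
    (∫⁻ x, ENNReal.ofReal (majorant T (μ - q.1 ^ 2 - q.2 ^ 2) q x y)) ^ 2 ≤
      ENNReal.ofReal (4 * (288 * log (μ / T)) ^ 2) * ENNReal.ofReal (profile T (√μ) y) := by
  have hμ : 0 < μ := by linarith
  have hs : 0 < √μ := sqrt_pos.2 hμ
  have hsq : √μ ^ 2 = μ := sq_sqrt hμ.le
  have hB : 0 < T + √μ * |y| + y ^ 2 := by positivity
  have hy0 : 0 ≤ |y| := abs_nonneg y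
  obtain ⟨ha1, ha2⟩ := abs_lt.1 ha
  unfold profile majorant
  set a := μ - q.1 ^ 2 - q.2 ^ 2 with hadef
  rcases le_or_gt (√μ) |y| with hy | hy
  · have hy2 : μ ≤ y ^ 2 := by rw [← hsq, ← sq_abs y]; gcongr
    have hpos : 0 < T + |a - y ^ 2| := by positivity
    refine ofReal_div_sq_le (sqrt_pos.2 hpos) hB ?_ (lintegral_slice_le_of_le q.1 (y * q.2) hT hTμ
      (by linarith [sq_nonneg y]))
    rw [sq_sqrt hpos.le, abs_of_nonpos (by linarith : a - y ^ 2 ≤ 0)]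
    nlinarith [sq_abs y]
  · have hy2 : y ^ 2 ≤ √μ * |y| := by rw [← sq_abs y]; nlinarith
    have hle : T + √μ * |y| + y ^ 2 ≤ 3 * μ := by nlinarith
    have hor : √μ / 2 ≤ |q.1| ∨ √μ / 2 ≤ |q.2| := by
      by_contra! hcon
      have h1 : q.1 ^ 2 ≤ μ / 4 := by
        rw [← sq_abs]; nlinarith [hcon.1, abs_nonneg q.1]
      have h2 : q.2 ^ 2 ≤ μ / 4 := by
        rw [← sq_abs]; nlinarith [hcon.2, abs_nonneg q.2]
      linarith
    rcases hor with hq | hq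
    · have hh : (√μ / 2) ^ 2 = μ / 4 := by rw [div_pow, hsq]; norm_num
      have hlog : log (2 * (√μ / 2) ^ 2 / T) ≤ log (μ / T) := by
        rw [hh]
        refine log_le_log (by positivity) ?_
        gcongr
        linarith
      refine ofReal_div_sq_le hs hB (by linarith) ((lintegral_slice_le hT (half_pos hs)
        (by rw [hh]; linarith) (Or.inl hq)).trans (ENNReal.ofReal_le_ofReal ?_))
      rw [div_div_eq_mul_div]
      gcongr ?_ / _
      linarith [one_le_log_div hT hTμ]
    · set k := y * q.2
      have hk : |k| = |y| * |q.2| := abs_mul _ _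
      have hpos : 0 < T + |k| := by positivity
      have hq2 : |q.2| ≤ 2 * √μ := by
        refine abs_le_of_sq_le_sq ?_ (by positivity)
        rw [mul_pow, hsq]
        linarith [sq_nonneg q.1]
      refine ofReal_div_sq_le (sqrt_pos.2 hpos) hB ?_ (lintegral_slice_le_log hT hTμ
        (sqrt_pos.2 hpos) ?_ ?_ (Or.inr (Or.inl (sq_sqrt hpos.le).le)))
      · rw [sq_sqrt hpos.le, hk]
        nlinarith [mul_le_mul_of_nonneg_left hq hy0]
      · rw [sq_sqrt hpos.le]; linarith [abs_nonneg k]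
      · rw [sq_sqrt hpos.le, hk]
        nlinarith [mul_le_mul hy.le hq2 (abs_nonneg q.2) hs.le]

theorem lintegral_sq_slice_le {μ T : ℝ} (hT : 0 < T) (hTμ : T < μ / 4) (q : ℝ × ℝ) :
    ∫⁻ y, (∫⁻ x, ENNReal.ofReal (majorant T (μ - q.1 ^ 2 - q.2 ^ 2) q x y)) ^ 2 ≤
      ENNReal.ofReal (4 * 288 ^ 3 / √μ * log (μ / T) ^ 3) := by
  have hμ : 0 < μ := by linarith
  have hs : 0 < √μ := sqrt_pos.2 hμ
  have hsq : √μ ^ 2 = μ := sq_sqrt hμ.le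
  have hL := one_le_log_div hT hTμ
  set L := log (μ / T)
  rcases lt_or_ge |μ - q.1 ^ 2 - q.2 ^ 2| (μ / 2) with ha | ha
  · have hprof := lintegral_profile_le hT hs (by rw [hsq]; linarith)
    have hlog := log_le_three_mul_log hT hTμ (by positivity : 0 < 2 * √μ ^ 2) (by linarith)
    refine (lintegral_mono (sq_slice_le_profile hT hTμ q ha)).trans ?_
    rw [lintegral_const_mul' _ _ ENNReal.ofReal_ne_top]
    refine (mul_le_mul_right hprof _).trans ?_
    rw [← ENNReal.ofReal_mul (by positivity)]
    refine ENNReal.ofReal_le_ofReal ?_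
    calc 4 * (288 * L) ^ 2 * (6 * log (2 * √μ ^ 2 / T) / √μ)
        ≤ 4 * (288 * L) ^ 2 * (6 * (3 * L) / √μ) := by gcongr
      _ = 72 * 288 ^ 2 / √μ * L ^ 3 := by ring
      _ ≤ _ := by
        refine mul_le_mul_of_nonneg_right ?_ (by positivity)
        refine div_le_div_of_nonneg_right ?_ hs.le
        norm_num
  · have hle (y : ℝ) :
        (∫⁻ x, ENNReal.ofReal (majorant T (μ - q.1 ^ 2 - q.2 ^ 2) q x y)) ^ 2 ≤
        ENNReal.ofReal (1 * (288 * L) ^ 2) *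
          ENNReal.ofReal (1 / (T + |y ^ 2 - (μ - q.1 ^ 2 - q.2 ^ 2)| + |y * 0 + 0|)) := by
      have hpos : 0 < T + |(μ - q.1 ^ 2 - q.2 ^ 2) - y ^ 2| := by positivity
      refine ofReal_div_sq_le (sqrt_pos.2 hpos) (by positivity) ?_
        (lintegral_slice_le_of_le q.1 (y * q.2) hT hTμ
          (by linarith [sq_nonneg y, sq_nonneg q.1, sq_nonneg q.2]))
      rw [sq_sqrt hpos.le, abs_sub_comm]
      simp
    refine (lintegral_mono hle).trans ?_
    rw [lintegral_const_mul' _ _ ENNReal.ofReal_ne_top]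
    refine (mul_le_mul_right (lintegral_slice_le_of_le 0 0 hT hTμ
      (by linarith [sq_nonneg q.1, sq_nonneg q.2])) _).trans ?_
    rw [← ENNReal.ofReal_mul (by positivity)]
    refine ENNReal.ofReal_le_ofReal ?_
    have hroot : √μ / 2 ≤ √(T + |μ - q.1 ^ 2 - q.2 ^ 2|) := by
      refine le_sqrt_of_sq_le ?_
      rw [div_pow, hsq]
      linarith
    calc 1 * (288 * L) ^ 2 * (288 * L / √(T + |μ - q.1 ^ 2 - q.2 ^ 2|))
        ≤ 1 * (288 * L) ^ 2 * (288 * L / (√μ / 2)) := by gcongr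
      _ = 2 * 288 ^ 3 / √μ * L ^ 3 := by field_simp
      _ ≤ _ := by gcongr; norm_num

theorem lintegral_mul_slices {f g : ℝ → ℝ → ENNReal} (hf : Measurable (Function.uncurry f))
    (hg : Measurable (Function.uncurry g)) :
    ∫⁻ z : ℝ × ℝ × ℝ, f z.1 z.2.2 * g z.2.1 z.2.2 =
      ∫⁻ y, (∫⁻ x, f x y) * ∫⁻ x, g x y := by
  have hf' : Measurable fun z : ℝ × ℝ × ℝ => f z.1 z.2.2 :=
    hf.comp (measurable_fst.prodMk (measurable_snd.comp measurable_snd))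
  have hg' : Measurable fun z : ℝ × ℝ => g z.1 z.2 := hg
  have hF : Measurable fun y => ∫⁻ x, f x y := hf.lintegral_prod_left
  have hfg : Measurable fun z : ℝ × ℝ × ℝ => f z.1 z.2.2 * g z.2.1 z.2.2 :=
    hf'.mul (hg'.comp measurable_snd)
  have hFg : Measurable fun z : ℝ × ℝ => (∫⁻ x, f x z.2) * g z.1 z.2 :=
    (hF.comp measurable_snd).mul hg'
  rw [Measure.volume_eq_prod ℝ (ℝ × ℝ), lintegral_prod_symm' _ hfg]
  have hinner (z : ℝ × ℝ) :
      ∫⁻ x, f x z.2 * g z.1 z.2 = (∫⁻ x, f x z.2) * g z.1 z.2 :=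
    lintegral_mul_const _ hf.of_uncurry_right
  simp only [hinner]
  rw [Measure.volume_eq_prod ℝ ℝ, lintegral_prod_symm' _ hFg]
  refine lintegral_congr fun y => ?_
  dsimp only
  exact lintegral_const_mul _ hg.of_uncurry_right

theorem mul_le_sq_add_sq (a b : ENNReal) : a * b ≤ a ^ 2 + b ^ 2 := by
  rcases le_total a b with h | h
  · exact (mul_le_mul_left h b).trans (by rw [← sq]; exact le_add_self)
  · exact (mul_le_mul_right h a).trans (by rw [← sq]; exact le_self_add)

/-- `sup_{q,q'} ∫_{ℝ³} B_T((p₁,p₂),q) B_T((p₁',p₂),q') dp₁ dp₁' dp₂ = O((log(μ/T))³)`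
as `T → 0`. The integration variable is `x = (p₁, p₁', p₂)`. -/
theorem BT_product_integral_bound (μ : ℝ) (hμ : 0 < μ) :
    ∃ C > (0 : ℝ), ∃ T₀ : ℝ, 0 < T₀ ∧ T₀ < μ ∧ ∀ T, 0 < T → T < T₀ →
      ∀ q q' : ℝ × ℝ,
        (∫ x : ℝ × ℝ × ℝ, BT T μ (x.1, x.2.2) q * BT T μ (x.2.1, x.2.2) q') ≤
          C * (Real.log (μ / T)) ^ 3 := by
  have hs : 0 < √μ := sqrt_pos.2 hμ
  refine ⟨9 * (2 * (4 * 288 ^ 3 / √μ)), by positivity, μ / 4, by positivity, by linarith,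
    fun T hT hTμ q q' => ?_⟩
  have hL := one_le_log_div hT hTμ
  set f : ℝ → ℝ → ENNReal :=
    fun x y => ENNReal.ofReal (majorant T (μ - q.1 ^ 2 - q.2 ^ 2) q x y) with hf
  set g : ℝ → ℝ → ENNReal :=
    fun x y => ENNReal.ofReal (majorant T (μ - q'.1 ^ 2 - q'.2 ^ 2) q' x y) with hg
  have hfm : Measurable (Function.uncurry f) :=
    (measurable_uncurry_majorant T (μ - q.1 ^ 2 - q.2 ^ 2) q).ennreal_ofReal
  have hgm : Measurable (Function.uncurry g) :=
    (measurable_uncurry_majorant T (μ - q'.1 ^ 2 - q'.2 ^ 2) q').ennreal_ofReal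
  refine (le_norm_self _).trans ((norm_integral_le_lintegral_norm _).trans ?_)
  refine ENNReal.toReal_le_of_le_ofReal (by positivity) ?_
  have hbound (x : ℝ × ℝ × ℝ) :
      ENNReal.ofReal ‖BT T μ (x.1, x.2.2) q * BT T μ (x.2.1, x.2.2) q'‖ ≤
        ENNReal.ofReal 9 * (f x.1 x.2.2 * g x.2.1 x.2.2) := by
    have h1 := abs_BT_le_s5 hT μ q x.1 x.2.2
    have h2 := abs_BT_le_s5 hT μ q' x.2.1 x.2.2
    have h3 := mul_le_mul h1 h2 (abs_nonneg _) ((abs_nonneg _).trans h1)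
    simp only [hf, hg]
    rw [← ENNReal.ofReal_mul (majorant_nonneg hT _ _ _ _), ← ENNReal.ofReal_mul (by norm_num),
      norm_eq_abs, abs_mul]
    exact ENNReal.ofReal_le_ofReal (h3.trans_eq (by ring))
  have hF : Measurable fun y => (∫⁻ x, f x y) ^ 2 := (hfm.lintegral_prod_left).pow_const 2
  calc ∫⁻ x : ℝ × ℝ × ℝ, ENNReal.ofReal ‖BT T μ (x.1, x.2.2) q * BT T μ (x.2.1, x.2.2) q'‖
      ≤ ∫⁻ x : ℝ × ℝ × ℝ, ENNReal.ofReal 9 * (f x.1 x.2.2 * g x.2.1 x.2.2) :=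
        lintegral_mono hbound
    _ = ENNReal.ofReal 9 * ∫⁻ y, (∫⁻ x, f x y) * ∫⁻ x, g x y := by
        rw [lintegral_const_mul' _ _ ENNReal.ofReal_ne_top, lintegral_mul_slices hfm hgm]
    _ ≤ ENNReal.ofReal 9 * ∫⁻ y, ((∫⁻ x, f x y) ^ 2 + (∫⁻ x, g x y) ^ 2) := by
        gcongr
        exact mul_le_sq_add_sq _ _
    _ = ENNReal.ofReal 9 * ((∫⁻ y, (∫⁻ x, f x y) ^ 2) + ∫⁻ y, (∫⁻ x, g x y) ^ 2) := by
        rw [lintegral_add_left hF]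
    _ ≤ ENNReal.ofReal 9 * (ENNReal.ofReal (4 * 288 ^ 3 / √μ * log (μ / T) ^ 3) +
          ENNReal.ofReal (4 * 288 ^ 3 / √μ * log (μ / T) ^ 3)) := by
        gcongr
        · exact lintegral_sq_slice_le hT hTμ q
        · exact lintegral_sq_slice_le hT hTμ q'
    _ = _ := by
        rw [← ENNReal.ofReal_add (by positivity) (by positivity),
          ← ENNReal.ofReal_mul (by norm_num)]
        congr 1
        ring
end

section
/- Let μ > 0, T > 0 and c ≥ 0. Then ∫_{(−√(2μ),√(2μ))²} 1 / max{ (p² + q² + c − μ)², T² } dp dq ≤ 4π / T. -/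
open MeasureTheory Real

/-- Over `(T, ∞)`, the integral of `1 / max (x², T²)` is at most `1 / T`. -/
lemma lintegral_Ioi_one_div_max_sq_le {T : ℝ} (hT : 0 < T) :
    ∫⁻ x in Set.Ioi T, ENNReal.ofReal (1 / max (x ^ 2) (T ^ 2)) ≤ ENNReal.ofReal (1 / T) := by
  have hle : ∫⁻ x in Set.Ioi T, ENNReal.ofReal (1 / max (x ^ 2) (T ^ 2)) ≤
      ∫⁻ x in Set.Ioi T, ENNReal.ofReal (x ^ (-2 : ℝ)) := by
    refine setLIntegral_mono' measurableSet_Ioi fun x hx => ENNReal.ofReal_le_ofReal ?_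
    have hx0 : 0 < x := hT.trans hx
    rw [Real.rpow_neg hx0.le, Real.rpow_two, ← one_div]
    exact one_div_le_one_div_of_le (by positivity) (le_max_left _ _)
  refine hle.trans ?_
  rw [← ofReal_integral_eq_lintegral_ofReal (integrableOn_Ioi_rpow_of_lt (by norm_num) hT)
    ((ae_restrict_iff' measurableSet_Ioi).2 (.of_forall fun x hx =>
      Real.rpow_nonneg (hT.trans hx).le _)), integral_Ioi_rpow_of_lt (by norm_num) hT]
  refine ENNReal.ofReal_le_ofReal (le_of_eq ?_)
  norm_num [Real.rpow_neg_one]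

/-- The integral of `1 / max (x², T²)` over the real line is at most `4 / T`. -/
lemma lintegral_one_div_max_sq_le {T : ℝ} (hT : 0 < T) :
    ∫⁻ x : ℝ, ENNReal.ofReal (1 / max (x ^ 2) (T ^ 2)) ≤ ENNReal.ofReal (4 / T) := by
  have hneg : ∫⁻ x in Set.Iio (-T), ENNReal.ofReal (1 / max (x ^ 2) (T ^ 2)) ≤
      ENNReal.ofReal (1 / T) := by
    have h := (Measure.measurePreserving_neg (volume : Measure ℝ)).setLIntegral_comp_preimage_emb
      (MeasurableEquiv.neg ℝ).measurableEmbedding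
      (fun x => ENNReal.ofReal (1 / max (x ^ 2) (T ^ 2))) (Set.Ioi T)
    simp only [Set.neg_preimage, Set.neg_Ioi, neg_sq] at h
    exact h.trans_le (lintegral_Ioi_one_div_max_sq_le hT)
  have hmid : ∫⁻ x in Set.Icc (-T) T, ENNReal.ofReal (1 / max (x ^ 2) (T ^ 2)) ≤
      ENNReal.ofReal (2 / T) := by
    calc _ ≤ ∫⁻ _ in Set.Icc (-T) T, ENNReal.ofReal (1 / T ^ 2) :=
          lintegral_mono fun x => ENNReal.ofReal_le_ofReal
            (one_div_le_one_div_of_le (by positivity) (le_max_right _ _))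
      _ = ENNReal.ofReal (2 / T) := by
          rw [setLIntegral_const, Real.volume_Icc, ← ENNReal.ofReal_mul (by positivity)]
          congr 1
          field_simp
          ring
  have hcover : (Set.univ : Set ℝ) ⊆ (Set.Iio (-T) ∪ Set.Icc (-T) T) ∪ Set.Ioi T := by
    intro x _
    simp only [Set.mem_union, Set.mem_Iio, Set.mem_Icc, Set.mem_Ioi]
    grind
  rw [← setLIntegral_univ]
  calc _ ≤ _ := lintegral_mono_set hcover
    _ ≤ _ := lintegral_union_le _ _ _
    _ ≤ _ := add_le_add_left (lintegral_union_le _ _ _) _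
    _ ≤ ENNReal.ofReal (1 / T) + ENNReal.ofReal (2 / T) + ENNReal.ofReal (1 / T) :=
        add_le_add (add_le_add hneg hmid) (lintegral_Ioi_one_div_max_sq_le hT)
    _ = ENNReal.ofReal (4 / T) := by
        rw [← ENNReal.ofReal_add (by positivity) (by positivity),
          ← ENNReal.ofReal_add (by positivity) (by positivity)]
        congr 1
        ring

/-- The planar integral of a function of `x² + y²` is `π` times its integral over `(0, ∞)`. -/
lemma lintegral_comp_sq_add_sq {g : ℝ → ENNReal} (hg : Measurable g) :
    ∫⁻ x : ℝ × ℝ, g (x.1 ^ 2 + x.2 ^ 2) = ENNReal.ofReal π * ∫⁻ s in Set.Ioi 0, g s := by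
  have himage : (fun r : ℝ => r ^ 2) '' Set.Ioi 0 = Set.Ioi 0 := by
    ext s
    simp only [Set.mem_image, Set.mem_Ioi]
    exact ⟨by rintro ⟨r, hr, rfl⟩; positivity,
      fun hs => ⟨√s, Real.sqrt_pos.2 hs, Real.sq_sqrt hs.le⟩⟩
  have hsubst := lintegral_image_eq_lintegral_abs_deriv_mul (s := Set.Ioi (0 : ℝ))
    (f := fun r => r ^ 2) (f' := fun r => 2 * r) measurableSet_Ioi
    (fun r _ => by simpa using (hasDerivAt_pow 2 r).hasDerivWithinAt)
    (fun a ha b hb hab => (pow_left_inj₀ (le_of_lt ha) (le_of_lt hb) two_ne_zero).1 hab) g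
  rw [himage] at hsubst
  have hradial : ∀ p : ℝ × ℝ, ENNReal.ofReal p.1 • g ((polarCoord.symm p).1 ^ 2 +
      (polarCoord.symm p).2 ^ 2) = ENNReal.ofReal p.1 * g (p.1 ^ 2) := by
    intro p
    rw [polarCoord_symm_apply, smul_eq_mul]
    congr 2
    linear_combination p.1 ^ 2 * Real.cos_sq_add_sin_sq p.2
  have hscale : ∫⁻ r in Set.Ioi (0 : ℝ), ENNReal.ofReal |2 * r| * g (r ^ 2) =
      2 * ∫⁻ r in Set.Ioi (0 : ℝ), ENNReal.ofReal r * g (r ^ 2) := by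
    rw [← lintegral_const_mul _ (by fun_prop)]
    refine setLIntegral_congr_fun measurableSet_Ioi fun r hr => ?_
    have hr0 : (0 : ℝ) < r := hr
    rw [abs_of_pos (by positivity), ENNReal.ofReal_mul (by norm_num), mul_assoc]
    norm_num
  rw [← lintegral_comp_polarCoord_symm]
  simp_rw [hradial]
  rw [polarCoord_target, Measure.volume_eq_prod, ← Measure.prod_restrict,
    lintegral_prod _ (by fun_prop), hsubst, hscale]
  simp only [lintegral_const, Measure.restrict_apply_univ, Real.volume_Ioo]
  rw [lintegral_mul_const _ (by fun_prop), sub_neg_eq_add, ← two_mul,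
    ENNReal.ofReal_mul (by norm_num), ENNReal.ofReal_ofNat]
  ring

/-- `∫_{(−√(2μ),√(2μ))²} 1 / max{(p² + q² + c − μ)², T²} dp dq ≤ 4π / T`. -/
theorem max_kernel_integral_bound (μ T c : ℝ) (hμ : 0 < μ) (hT : 0 < T) (hc : 0 ≤ c) :
    (∫ x in (Set.Ioo (-Real.sqrt (2 * μ)) (Real.sqrt (2 * μ))) ×ˢ
        (Set.Ioo (-Real.sqrt (2 * μ)) (Real.sqrt (2 * μ))),
        1 / max ((x.1 ^ 2 + x.2 ^ 2 + c - μ) ^ 2) (T ^ 2)) ≤ 4 * Real.pi / T := by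
  rw [integral_eq_lintegral_of_nonneg_ae (.of_forall fun x => by positivity)
    (Measurable.aestronglyMeasurable (by fun_prop))]
  refine ENNReal.toReal_le_of_le_ofReal (by positivity) ?_
  have hmeas : Measurable fun s : ℝ =>
      ENNReal.ofReal (1 / max ((s + c - μ) ^ 2) (T ^ 2)) := by fun_prop
  calc _ ≤ ∫⁻ x : ℝ × ℝ, ENNReal.ofReal
          (1 / max ((x.1 ^ 2 + x.2 ^ 2 + c - μ) ^ 2) (T ^ 2)) := setLIntegral_le_lintegral _ _
    _ = ENNReal.ofReal π * ∫⁻ s in Set.Ioi 0,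
          ENNReal.ofReal (1 / max ((s + c - μ) ^ 2) (T ^ 2)) := lintegral_comp_sq_add_sq hmeas
    _ ≤ ENNReal.ofReal π * ∫⁻ s : ℝ, ENNReal.ofReal (1 / max ((s + c - μ) ^ 2) (T ^ 2)) := by
        gcongr
        exact Measure.restrict_le_self
    _ = ENNReal.ofReal π * ∫⁻ s : ℝ, ENNReal.ofReal (1 / max (s ^ 2) (T ^ 2)) := by
        simp_rw [add_sub_assoc]
        rw [lintegral_add_right_eq_self
          (fun s : ℝ => ENNReal.ofReal (1 / max (s ^ 2) (T ^ 2))) (c - μ)]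
    _ ≤ ENNReal.ofReal π * ENNReal.ofReal (4 / T) := by
        gcongr
        exact lintegral_one_div_max_sq_le hT
    _ = ENNReal.ofReal (4 * π / T) := by
        rw [← ENNReal.ofReal_mul pi_pos.le]
        congr 1
        ring
end
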